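/- arXiv:2404.03151 — 3 statements merged into one kernel-verified Lean document; each statement's English description precedes it below -/
import Mathlib

section
/- Let G be a simple connected graph on n vertices and let A be a real symmetric n×n matrix satisfying the Nodal Count Condition for G (A is strictly supported on G, has simple eigenvalues λ_1<…<λ_n, and every eigenvector φ_k is nowhere-vanishing). Then the total nodal surplus is bounded below by the first Betti number: β(G) ≤ Σ_{k=1}^{n} [ν(A,φ_k) − (k−1)]. -/
open Matrix

/-- A matrix is supported on a simple graph `G` if its off-diagonal entries vanish
outside the edges of `G`. -/
def SupportedOn {V : Type*} (G : SimpleGraph V) (A : Matrix V V ℝ) : Prop :=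
  ∀ i j, i ≠ j → ¬ G.Adj i j → A i j = 0

/-- The nodal (edge sign-change) count of a vector `φ` with respect to a matrix `A`:
the number of pairs `i < j` with `A i j * φ i * φ j > 0`. -/
noncomputable def nodalCount {n : ℕ} (A : Matrix (Fin n) (Fin n) ℝ) (φ : Fin n → ℝ) : ℕ :=
  Nat.card {p : Fin n × Fin n // p.1 < p.2 ∧ 0 < A p.1 p.2 * φ p.1 * φ p.2}

/-- The first Betti number of a graph on `n` vertices: `|E(G)| - (n - 1)`. -/
noncomputable def betti {n : ℕ} (G : SimpleGraph (Fin n)) : ℕ :=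
  Nat.card G.edgeSet - (n - 1)

/-- The matrix element between the vectors `ψ m` and `ψ k` of the entrywise product of `A` and
`a`. -/
noncomputable def hadamardForm {n : ℕ} (A : Matrix (Fin n) (Fin n) ℝ) (ψ : Fin n → Fin n → ℝ)
    (m k : Fin n) : (Fin n → Fin n → ℝ) →ₗ[ℝ] ℝ where
  toFun a := ∑ i, ψ m i * ∑ j, A i j * a i j * ψ k j
  map_add' a b := by
    simp only [Pi.add_apply, Finset.sum_add_distrib, mul_add, add_mul]
  map_smul' c a := by
    simp only [Pi.smul_apply, smul_eq_mul, Finset.mul_sum, RingHom.id_apply]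
    refine Finset.sum_congr rfl fun i _ => Finset.sum_congr rfl fun j _ => ?_
    ring

theorem hadamardForm_apply {n : ℕ} (A : Matrix (Fin n) (Fin n) ℝ) (ψ : Fin n → Fin n → ℝ)
    (m k : Fin n) (a : Fin n → Fin n → ℝ) :
    hadamardForm A ψ m k a = ∑ i, ψ m i * ∑ j, A i j * a i j * ψ k j := rfl

/-- The second variation of the eigenvalue `lam k` of `A` under the magnetic perturbation
`A i j * exp (t * a i j * I)`, given an orthonormal eigenbasis `ψ`. -/
noncomputable def magneticHessian {n : ℕ} (A : Matrix (Fin n) (Fin n) ℝ) (lam : Fin n → ℝ)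
    (ψ : Fin n → Fin n → ℝ) (k : Fin n) (a : Fin n → Fin n → ℝ) : ℝ :=
  2 * ∑ m, hadamardForm A ψ m k a ^ 2 / (lam k - lam m)
    - ∑ i, ∑ j, A i j * a i j ^ 2 * (ψ k i * ψ k j)

theorem hadamardForm_antisymm {n : ℕ} {A : Matrix (Fin n) (Fin n) ℝ} (hA : A.IsSymm)
    (ψ : Fin n → Fin n → ℝ) {a : Fin n → Fin n → ℝ} (ha : ∀ i j, a j i = -a i j)
    (m k : Fin n) : hadamardForm A ψ k m a = -hadamardForm A ψ m k a := by
  simp only [hadamardForm_apply, Finset.mul_sum, ← Finset.sum_neg_distrib]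
  rw [Finset.sum_comm]
  refine Finset.sum_congr rfl fun i _ => Finset.sum_congr rfl fun j _ => ?_
  rw [ha, hA.apply]
  ring

theorem sum_mul_eq_of_orthonormal {n : ℕ} {ψ : Fin n → Fin n → ℝ}
    (hψ : Matrix.of ψ * (Matrix.of ψ)ᵀ = 1) (i j : Fin n) :
    ∑ k, ψ k i * ψ k j = if i = j then 1 else 0 := by
  have h := congrArg (fun M : Matrix (Fin n) (Fin n) ℝ => M i j) (mul_eq_one_comm.mp hψ)
  simpa [Matrix.mul_apply, Matrix.one_apply] using h

theorem parseval_of_orthonormal {n : ℕ} {ψ : Fin n → Fin n → ℝ}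
    (hψ : Matrix.of ψ * (Matrix.of ψ)ᵀ = 1) (x y : Fin n → ℝ) :
    ∑ m, (∑ i, ψ m i * x i) * (∑ i, ψ m i * y i) = ∑ i, x i * y i := by
  have h : (Matrix.of ψ *ᵥ x) ⬝ᵥ (Matrix.of ψ *ᵥ y) = x ⬝ᵥ y := by
    rw [← Matrix.vecMul_transpose, ← Matrix.dotProduct_mulVec, Matrix.mulVec_mulVec,
      mul_eq_one_comm.mp hψ, Matrix.one_mulVec]
  exact h

theorem sum_magneticHessian {n : ℕ} {A : Matrix (Fin n) (Fin n) ℝ} (hA : A.IsSymm)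
    (lam : Fin n → ℝ) {ψ : Fin n → Fin n → ℝ} (hψ : Matrix.of ψ * (Matrix.of ψ)ᵀ = 1)
    {a : Fin n → Fin n → ℝ} (ha : ∀ i j, a j i = -a i j) :
    ∑ k, magneticHessian A lam ψ k a = 0 := by
  have h1 : ∑ k, ∑ m, hadamardForm A ψ m k a ^ 2 / (lam k - lam m) = 0 := by
    have h : ∑ k, ∑ m, hadamardForm A ψ m k a ^ 2 / (lam k - lam m)
        = -∑ k, ∑ m, hadamardForm A ψ m k a ^ 2 / (lam k - lam m) := by
      conv_lhs => rw [Finset.sum_comm]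
      simp only [← Finset.sum_neg_distrib]
      refine Finset.sum_congr rfl fun k _ => Finset.sum_congr rfl fun m _ => ?_
      rw [hadamardForm_antisymm hA ψ ha m k, ← neg_sub (lam k) (lam m), div_neg, neg_sq]
    linarith
  have h2 : ∑ k, ∑ i, ∑ j, A i j * a i j ^ 2 * (ψ k i * ψ k j) = 0 := by
    rw [Finset.sum_comm]
    refine Finset.sum_eq_zero fun i _ => ?_
    rw [Finset.sum_comm]
    refine Finset.sum_eq_zero fun j _ => ?_
    rw [← Finset.mul_sum, sum_mul_eq_of_orthonormal hψ]
    split_ifs with h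
    · subst h
      have : a i i = 0 := by linarith [ha i i]
      simp [this]
    · simp
  simp only [magneticHessian, Finset.sum_sub_distrib, ← Finset.mul_sum, h1, h2]
  simp

theorem hadamardForm_gradient {n : ℕ} {A : Matrix (Fin n) (Fin n) ℝ} (hA : A.IsSymm)
    {lam : Fin n → ℝ} {ψ : Fin n → Fin n → ℝ} (heig : ∀ k, A.mulVec (ψ k) = lam k • ψ k)
    (u : Fin n → ℝ) (m k : Fin n) :
    hadamardForm A ψ m k (fun i j => u i - u j)
      = (lam k - lam m) * ∑ i, ψ m i * (u i * ψ k i) := by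
  have he : ∀ k i, ∑ j, A i j * ψ k j = lam k * ψ k i := fun k i => congrFun (heig k) i
  have h1 : ∑ i, ψ m i * ∑ j, A i j * u i * ψ k j
      = lam k * ∑ i, ψ m i * (u i * ψ k i) := by
    rw [Finset.mul_sum]
    refine Finset.sum_congr rfl fun i _ => ?_
    have : ∑ j, A i j * u i * ψ k j = u i * ∑ j, A i j * ψ k j := by
      rw [Finset.mul_sum]
      exact Finset.sum_congr rfl fun j _ => by ring
    rw [this, he]
    ring
  have h2 : ∑ i, ψ m i * ∑ j, A i j * u j * ψ k j
      = lam m * ∑ i, ψ m i * (u i * ψ k i) := by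
    simp only [Finset.mul_sum]
    rw [Finset.sum_comm]
    refine Finset.sum_congr rfl fun j _ => ?_
    have : ∑ i, ψ m i * (A i j * u j * ψ k j) = u j * ψ k j * ∑ i, A j i * ψ m i := by
      rw [Finset.mul_sum]
      exact Finset.sum_congr rfl fun i _ => by rw [hA.apply]; ring
    rw [this, he]
    ring
  rw [sub_mul, ← h1, ← h2, hadamardForm_apply]
  simp only [mul_sub, sub_mul, Finset.sum_sub_distrib]

theorem magneticHessian_add_gradient {n : ℕ} {A : Matrix (Fin n) (Fin n) ℝ} (hA : A.IsSymm)
    {lam : Fin n → ℝ} (hlam : Function.Injective lam) {ψ : Fin n → Fin n → ℝ}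
    (hψ : Matrix.of ψ * (Matrix.of ψ)ᵀ = 1) (heig : ∀ k, A.mulVec (ψ k) = lam k • ψ k)
    {a : Fin n → Fin n → ℝ} (ha : ∀ i j, a j i = -a i j) (u : Fin n → ℝ) (k : Fin n) :
    magneticHessian A lam ψ k (a + fun i j => u i - u j) = magneticHessian A lam ψ k a := by
  set d : Fin n → Fin n → ℝ := fun i j => u i - u j with hd
  set c : Fin n → Fin n → ℝ := a + (a + d) with hc
  have hterm : ∀ m, hadamardForm A ψ m k (a + d) ^ 2 / (lam k - lam m)
      - hadamardForm A ψ m k a ^ 2 / (lam k - lam m)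
      = hadamardForm A ψ m k c * ∑ i, ψ m i * (u i * ψ k i) := by
    intro m
    simp only [hc, map_add, hd, hadamardForm_gradient hA heig]
    rcases eq_or_ne m k with rfl | hmk
    · have := hadamardForm_antisymm hA ψ ha m m
      have h0 : hadamardForm A ψ m m a = 0 := by linarith
      simp [h0]
    · have : lam k - lam m ≠ 0 := sub_ne_zero.mpr fun h => hmk (hlam h).symm
      field_simp
      ring
  have hsum : ∑ m, hadamardForm A ψ m k (a + d) ^ 2 / (lam k - lam m)
      - ∑ m, hadamardForm A ψ m k a ^ 2 / (lam k - lam m)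
      = ∑ i, ∑ j, A i j * c i j * u i * (ψ k i * ψ k j) := by
    rw [← Finset.sum_sub_distrib, Finset.sum_congr rfl fun m _ => hterm m]
    simp only [hadamardForm_apply]
    rw [parseval_of_orthonormal hψ]
    refine Finset.sum_congr rfl fun i _ => ?_
    rw [Finset.sum_mul]
    exact Finset.sum_congr rfl fun j _ => by ring
  have hswap : ∑ i, ∑ j, A i j * c i j * u i * (ψ k i * ψ k j)
      = -∑ i, ∑ j, A i j * c i j * u j * (ψ k i * ψ k j) := by
    rw [Finset.sum_comm]
    simp only [← Finset.sum_neg_distrib]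
    refine Finset.sum_congr rfl fun i _ => Finset.sum_congr rfl fun j _ => ?_
    have : c j i = -c i j := by
      simp only [hc, hd, Pi.add_apply, ha i j]
      ring
    rw [this, hA.apply]
    ring
  have hdiag : ∑ i, ∑ j, A i j * (a + d) i j ^ 2 * (ψ k i * ψ k j)
      - ∑ i, ∑ j, A i j * a i j ^ 2 * (ψ k i * ψ k j)
      = ∑ i, ∑ j, A i j * c i j * u i * (ψ k i * ψ k j)
        - ∑ i, ∑ j, A i j * c i j * u j * (ψ k i * ψ k j) := by
    simp only [← Finset.sum_sub_distrib]
    refine Finset.sum_congr rfl fun i _ => Finset.sum_congr rfl fun j _ => ?_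
    simp only [hc, hd, Pi.add_apply]
    ring
  unfold magneticHessian
  linarith

theorem magneticHessian_congr {n : ℕ} {A : Matrix (Fin n) (Fin n) ℝ} (lam : Fin n → ℝ)
    (ψ : Fin n → Fin n → ℝ) (k : Fin n) {a b : Fin n → Fin n → ℝ}
    (h : ∀ i j, A i j ≠ 0 → a i j = b i j) :
    magneticHessian A lam ψ k a = magneticHessian A lam ψ k b := by
  have h1 : ∀ i j, A i j * a i j = A i j * b i j := fun i j => by
    by_cases hij : A i j = 0
    · simp [hij]
    · rw [h i j hij]
  have h2 : ∀ i j, A i j * a i j ^ 2 = A i j * b i j ^ 2 := fun i j => by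
    by_cases hij : A i j = 0
    · simp [hij]
    · rw [h i j hij]
  simp only [magneticHessian, hadamardForm_apply, h1, h2]

theorem magneticHessian_pos {n : ℕ} {A : Matrix (Fin n) (Fin n) ℝ} {lam : Fin n → ℝ}
    (hlam : StrictMono lam) {ψ : Fin n → Fin n → ℝ} (hnv : ∀ k i, ψ k i ≠ 0) {k : Fin n}
    {a : Fin n → Fin n → ℝ} (hpos : ∀ i j, 0 < A i j * ψ k i * ψ k j → a i j = 0)
    (horth : ∀ m, k < m → hadamardForm A ψ m k a = 0) {p q : Fin n} (hpq : A p q ≠ 0)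
    (hapq : a p q ≠ 0) : 0 < magneticHessian A lam ψ k a := by
  have h1 : 0 ≤ ∑ m, hadamardForm A ψ m k a ^ 2 / (lam k - lam m) := by
    refine Finset.sum_nonneg fun m _ => ?_
    rcases lt_or_ge k m with h | h
    · simp [horth m h]
    · exact div_nonneg (sq_nonneg _) (sub_nonneg.mpr (hlam.monotone h))
  have hle : ∀ i j, A i j * a i j ^ 2 * (ψ k i * ψ k j) ≤ 0 := by
    intro i j
    rcases lt_or_ge 0 (A i j * ψ k i * ψ k j) with h | h
    · simp [hpos i j h]
    · nlinarith [mul_nonneg (neg_nonneg.mpr h) (sq_nonneg (a i j))]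
  have hlt : A p q * a p q ^ 2 * (ψ k p * ψ k q) < 0 :=
    lt_of_le_of_ne (hle p q) (by simp [hpq, hapq, hnv])
  have h2 : ∑ i, ∑ j, A i j * a i j ^ 2 * (ψ k i * ψ k j) < 0 :=
    Finset.sum_neg' (fun i _ => Finset.sum_nonpos fun j _ => hle i j) ⟨p, Finset.mem_univ p,
      Finset.sum_neg' (fun j _ => hle p j) ⟨q, Finset.mem_univ q, hlt⟩⟩
  unfold magneticHessian
  linarith

theorem finrank_sub_finrank_iInf_le {V ι : Type*} [AddCommGroup V] [Module ℝ V]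
    [FiniteDimensional ℝ V] [Fintype ι] (N : ι → Submodule ℝ V) :
    (Module.finrank ℝ V : ℤ) - Module.finrank ℝ (⨅ k, N k : Submodule ℝ V)
      ≤ ∑ k, ((Module.finrank ℝ V : ℤ) - Module.finrank ℝ (N k)) := by
  classical
  suffices h : ∀ s : Finset ι, (Module.finrank ℝ V : ℤ)
      - Module.finrank ℝ (s.inf N : Submodule ℝ V)
      ≤ ∑ k ∈ s, ((Module.finrank ℝ V : ℤ) - Module.finrank ℝ (N k)) by
    rw [← Finset.inf_univ_eq_iInf]
    exact h Finset.univ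
  intro s
  induction s using Finset.induction_on with
  | empty => rw [Finset.inf_empty, finrank_top, Finset.sum_empty, sub_self]
  | insert k s hk ih =>
    rw [Finset.sum_insert hk, Finset.inf_insert]
    have h1 := Submodule.finrank_sup_add_finrank_inf_eq (N k) (s.inf N)
    have h2 := Submodule.finrank_le (N k ⊔ s.inf N)
    omega

/-- If subspaces `Z k` are disjoint from `I` and the sums `Z k ⊔ I` have no common vector
outside `I`, then the codimension of `I` is at most the sum of the codimensions of `Z k ⊔ I`. -/
theorem finrank_sub_le_sum_of_disjoint {V ι : Type*} [AddCommGroup V] [Module ℝ V]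
    [FiniteDimensional ℝ V] [Fintype ι] (I : Submodule ℝ V) (Z : ι → Submodule ℝ V)
    (hd : ∀ k, Disjoint (Z k) I) (hI : ∀ x, (∀ k, x ∈ Z k ⊔ I) → x ∈ I) :
    (Module.finrank ℝ V : ℤ) - Module.finrank ℝ I
      ≤ ∑ k, ((Module.finrank ℝ V : ℤ) - Module.finrank ℝ (Z k) - Module.finrank ℝ I) := by
  have h1 := finrank_sub_finrank_iInf_le fun k => Z k ⊔ I
  have h2 : Module.finrank ℝ (⨅ k, Z k ⊔ I : Submodule ℝ V) ≤ Module.finrank ℝ I :=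
    Submodule.finrank_mono fun x hx => hI x ((Submodule.mem_iInf _).mp hx)
  have h3 : ∀ k, (Module.finrank ℝ (Z k ⊔ I : Submodule ℝ V) : ℤ)
      = Module.finrank ℝ (Z k) + Module.finrank ℝ I := fun k => by
    have := Submodule.finrank_sup_add_finrank_inf_eq (Z k) I
    rw [(hd k).eq_bot, finrank_bot] at this
    omega
  simp only [h3, ← sub_sub] at h1
  omega

/-- The edges of `G`, oriented from the smaller to the larger endpoint. -/
abbrev OrientedEdge {n : ℕ} (G : SimpleGraph (Fin n)) : Type :=
  {p : Fin n × Fin n // p.1 < p.2 ∧ G.Adj p.1 p.2}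

theorem card_orientedEdge {n : ℕ} (G : SimpleGraph (Fin n)) :
    Nat.card (OrientedEdge G) = Nat.card G.edgeSet := by
  refine Nat.card_eq_of_bijective
    (fun e : OrientedEdge G => (⟨s(e.1.1, e.1.2), e.2.2⟩ : G.edgeSet)) ⟨?_, ?_⟩
  · rintro ⟨⟨i, j⟩, h, _⟩ ⟨⟨p, q⟩, h', _⟩ he
    have he := Sym2.eq_iff.mp (congrArg Subtype.val he)
    simp only at h h'
    rcases he with ⟨rfl, rfl⟩ | ⟨rfl, rfl⟩
    · rfl
    · exact absurd h h'.asymm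
  · rintro ⟨e, he⟩
    induction e using Sym2.ind with
    | _ i j =>
      have hadj : G.Adj i j := he
      rcases hadj.ne.lt_or_gt with h | h
      · exact ⟨⟨(i, j), h, hadj⟩, rfl⟩
      · exact ⟨⟨(j, i), h, hadj.symm⟩, Subtype.ext Sym2.eq_swap⟩

theorem finrank_orientedEdge_fun {n : ℕ} (G : SimpleGraph (Fin n)) :
    Module.finrank ℝ (OrientedEdge G → ℝ) = Nat.card G.edgeSet := by
  classical
  rw [Module.finrank_fintype_fun_eq_card, ← Nat.card_eq_fintype_card, card_orientedEdge]

open scoped Classical in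
/-- The antisymmetric array determined by its values on the oriented edges of `G`. -/
noncomputable def edgeArray {n : ℕ} (G : SimpleGraph (Fin n)) :
    (OrientedEdge G → ℝ) →ₗ[ℝ] (Fin n → Fin n → ℝ) where
  toFun x i j :=
    (if h : i < j ∧ G.Adj i j then x ⟨(i, j), h⟩ else 0)
      - (if h : j < i ∧ G.Adj j i then x ⟨(j, i), h⟩ else 0)
  map_add' x y := by
    ext i j
    simp only [Pi.add_apply]
    split_ifs <;> ring
  map_smul' c x := by
    ext i j
    simp only [Pi.smul_apply, smul_eq_mul, RingHom.id_apply]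
    split_ifs <;> ring

theorem edgeArray_swap {n : ℕ} (G : SimpleGraph (Fin n)) (x : OrientedEdge G → ℝ) (i j : Fin n) :
    edgeArray G x j i = -edgeArray G x i j := by
  simp [edgeArray]

theorem edgeArray_apply {n : ℕ} (G : SimpleGraph (Fin n)) (x : OrientedEdge G → ℝ)
    (e : OrientedEdge G) : edgeArray G x e.1.1 e.1.2 = x e := by
  obtain ⟨⟨i, j⟩, h⟩ := e
  simp only [edgeArray, LinearMap.coe_mk, AddHom.coe_mk]
  rw [dif_pos h, dif_neg fun h' => h.1.asymm h'.1, sub_zero]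

theorem edgeArray_eq_zero_of_not_adj {n : ℕ} (G : SimpleGraph (Fin n)) (x : OrientedEdge G → ℝ)
    {i j : Fin n} (h : ¬ G.Adj i j) : edgeArray G x i j = 0 := by
  simp [edgeArray, h, G.adj_comm j i]

/-- The gradient of a potential along the oriented edges. -/
def edgeGradient {n : ℕ} (G : SimpleGraph (Fin n)) : (Fin n → ℝ) →ₗ[ℝ] (OrientedEdge G → ℝ) where
  toFun u e := u e.1.1 - u e.1.2
  map_add' u v := by
    ext e
    simp only [Pi.add_apply]
    ring
  map_smul' c u := by
    ext e
    simp only [Pi.smul_apply, smul_eq_mul, RingHom.id_apply]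
    ring

theorem edgeGradient_apply {n : ℕ} (G : SimpleGraph (Fin n)) (u : Fin n → ℝ) (e : OrientedEdge G) :
    edgeGradient G u e = u e.1.1 - u e.1.2 := rfl

theorem edgeArray_edgeGradient {n : ℕ} (G : SimpleGraph (Fin n)) (u : Fin n → ℝ) {i j : Fin n}
    (h : G.Adj i j) : edgeArray G (edgeGradient G u) i j = u i - u j := by
  rcases h.ne.lt_or_gt with hij | hij
  · exact edgeArray_apply G _ ⟨(i, j), hij, h⟩
  · rw [edgeArray_swap, edgeArray_apply G _ ⟨(j, i), hij, h.symm⟩]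
    simp [edgeGradient_apply]

theorem finrank_range_edgeGradient {n : ℕ} {G : SimpleGraph (Fin n)} (hG : G.Connected) :
    Module.finrank ℝ (LinearMap.range (edgeGradient G)) + 1 = n := by
  obtain ⟨v⟩ := hG.nonempty
  have hker : LinearMap.ker (edgeGradient G) = ℝ ∙ (fun _ => 1 : Fin n → ℝ) := by
    ext u
    rw [LinearMap.mem_ker, Submodule.mem_span_singleton]
    constructor
    · intro hu
      have hadj : ∀ i j, G.Adj i j → u i = u j := fun i j hij => by
        have := edgeArray_edgeGradient G u hij
        rw [hu, map_zero] at this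
        simp only [Pi.zero_apply] at this
        linarith
      have hwalk : ∀ i j, G.Walk i j → u i = u j := fun i j w => by
        induction w with
        | nil => rfl
        | cons h _ ih => exact (hadj _ _ h).trans ih
      refine ⟨u v, funext fun i => ?_⟩
      obtain ⟨w⟩ := hG.preconnected v i
      simpa using hwalk v i w
    · rintro ⟨c, rfl⟩
      ext e
      simp [edgeGradient_apply]
  have h := LinearMap.finrank_range_add_finrank_ker (edgeGradient G)
  rw [hker, finrank_span_singleton (fun h => one_ne_zero (congrFun h v))] at h
  simpa using h

/-- The constraints cutting out a subspace of edge functions on which the magnetic Hessian of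
the `k`-th eigenvalue is positive. -/
noncomputable def nodalConstraint {n : ℕ} (G : SimpleGraph (Fin n))
    (A : Matrix (Fin n) (Fin n) ℝ) (ψ : Fin n → Fin n → ℝ) (k : Fin n) :
    (OrientedEdge G → ℝ) →ₗ[ℝ]
      ({p : Fin n × Fin n // p.1 < p.2 ∧ 0 < A p.1 p.2 * ψ k p.1 * ψ k p.2} → ℝ)
        × (Set.Ioi k → ℝ) :=
  LinearMap.prod
    (LinearMap.pi fun p => LinearMap.proj p.1.2 ∘ₗ LinearMap.proj p.1.1 ∘ₗ edgeArray G)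
    (LinearMap.pi fun m => hadamardForm A ψ m k ∘ₗ edgeArray G)

theorem mem_ker_nodalConstraint {n : ℕ} {G : SimpleGraph (Fin n)}
    {A : Matrix (Fin n) (Fin n) ℝ} (hA : A.IsSymm) {ψ : Fin n → Fin n → ℝ} {k : Fin n}
    {x : OrientedEdge G → ℝ} (hx : x ∈ LinearMap.ker (nodalConstraint G A ψ k)) :
    (∀ i j, 0 < A i j * ψ k i * ψ k j → edgeArray G x i j = 0)
      ∧ ∀ m, k < m → hadamardForm A ψ m k (edgeArray G x) = 0 := by
  rw [LinearMap.mem_ker, nodalConstraint, LinearMap.prod_apply] at hx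
  replace hx := Prod.mk_eq_zero.mp hx
  refine ⟨fun i j hij => ?_, fun m hm => congrFun hx.2 ⟨m, hm⟩⟩
  rcases lt_trichotomy i j with h | rfl | h
  · exact congrFun hx.1 ⟨(i, j), h, hij⟩
  · exact edgeArray_eq_zero_of_not_adj G x (G.irrefl)
  · have hji : 0 < A j i * ψ k j * ψ k i := by
      rw [hA.apply]
      linarith
    rw [edgeArray_swap, neg_eq_zero]
    exact congrFun hx.1 ⟨(j, i), h, hji⟩

theorem finrank_ker_nodalConstraint {n : ℕ} (G : SimpleGraph (Fin n))
    (A : Matrix (Fin n) (Fin n) ℝ) (ψ : Fin n → Fin n → ℝ) (k : Fin n) :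
    Nat.card G.edgeSet ≤ Module.finrank ℝ (LinearMap.ker (nodalConstraint G A ψ k))
      + nodalCount A (ψ k) + (n - 1 - k) := by
  have h1 := LinearMap.finrank_range_add_finrank_ker (nodalConstraint G A ψ k)
  have h2 := Submodule.finrank_le (LinearMap.range (nodalConstraint G A ψ k))
  rw [Module.finrank_prod, Module.finrank_fintype_fun_eq_card,
    Module.finrank_fintype_fun_eq_card, ← Nat.card_eq_fintype_card, Fintype.card_Ioi,
    Fin.card_Ioi] at h2
  rw [finrank_orientedEdge_fun] at h1
  unfold nodalCount
  omega

theorem total_nodal_surplus_lower_bound_of_orthonormal {n : ℕ} {G : SimpleGraph (Fin n)}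
    (hG : G.Connected) {A : Matrix (Fin n) (Fin n) ℝ} (hA : A.IsSymm)
    (hsupp : SupportedOn G A) (hstrict : ∀ i j, G.Adj i j → A i j ≠ 0)
    {lam : Fin n → ℝ} {ψ : Fin n → Fin n → ℝ} (hlam : StrictMono lam)
    (heig : ∀ k, A.mulVec (ψ k) = lam k • ψ k) (hnv : ∀ k i, ψ k i ≠ 0)
    (hψ : Matrix.of ψ * (Matrix.of ψ)ᵀ = 1) :
    (betti G : ℤ) ≤ ∑ k : Fin n, ((nodalCount A (ψ k) : ℤ) - ((k : ℕ) : ℤ)) := by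
  have hgauge : ∀ k x u, magneticHessian A lam ψ k (edgeArray G (x + edgeGradient G u))
      = magneticHessian A lam ψ k (edgeArray G x) := fun k x u => by
    rw [← magneticHessian_add_gradient hA hlam.injective hψ heig (edgeArray_swap G x) u k]
    refine magneticHessian_congr lam ψ k fun i j hij => ?_
    rw [map_add, Pi.add_apply, Pi.add_apply, Pi.add_apply, Pi.add_apply]
    by_cases h : G.Adj i j
    · rw [edgeArray_edgeGradient G u h]
    · obtain rfl : i = j := by
        by_contra hne
        exact hij (hsupp i j hne h)
      rw [edgeArray_eq_zero_of_not_adj G _ h, edgeArray_eq_zero_of_not_adj G _ h, sub_self]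
  have hpos : ∀ k, ∀ z ∈ LinearMap.ker (nodalConstraint G A ψ k), z ≠ 0 →
      0 < magneticHessian A lam ψ k (edgeArray G z) := fun k z hz hz0 => by
    obtain ⟨e, he⟩ := Function.ne_iff.mp hz0
    obtain ⟨h1, h2⟩ := mem_ker_nodalConstraint hA hz
    refine magneticHessian_pos hlam hnv h1 h2 (hstrict _ _ e.2.2) (p := e.1.1) (q := e.1.2) ?_
    rwa [edgeArray_apply]
  have hdim := finrank_sub_le_sum_of_disjoint (LinearMap.range (edgeGradient G))
    (fun k => LinearMap.ker (nodalConstraint G A ψ k)) (fun k => by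
      rw [Submodule.disjoint_def]
      rintro _ hz ⟨u, rfl⟩
      by_contra hne
      have h1 := hpos k _ hz hne
      have h2 := hgauge k 0 u
      rw [zero_add, map_zero] at h2
      rw [h2] at h1
      simp [magneticHessian] at h1) (fun x hx => by
      by_contra hxI
      have : Nonempty (Fin n) := hG.nonempty
      have h1 : 0 < ∑ k, magneticHessian A lam ψ k (edgeArray G x) := by
        refine Finset.sum_pos (fun k _ => ?_) Finset.univ_nonempty
        obtain ⟨z, hz, _, ⟨u, rfl⟩, rfl⟩ := Submodule.mem_sup.mp (hx k)
        rw [hgauge]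
        refine hpos k z hz ?_
        rintro rfl
        exact hxI ⟨u, (zero_add _).symm⟩
      exact h1.ne' (sum_magneticHessian hA lam hψ (edgeArray_swap G x)))
  have hr := finrank_range_edgeGradient hG
  rw [finrank_orientedEdge_fun] at hdim
  have hle : Module.finrank ℝ (LinearMap.range (edgeGradient G)) ≤ Nat.card G.edgeSet := by
    have h := Submodule.finrank_le (LinearMap.range (edgeGradient G))
    rwa [finrank_orientedEdge_fun] at h
  have hbetti : (betti G : ℤ)
      = (Nat.card G.edgeSet : ℤ) - Module.finrank ℝ (LinearMap.range (edgeGradient G)) := by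
    unfold betti
    omega
  rw [hbetti]
  refine hdim.trans (Finset.sum_le_sum fun k _ => ?_)
  have hk := finrank_ker_nodalConstraint G A ψ k
  have := k.isLt
  omega

theorem dotProduct_eq_zero_of_eigenvalue_ne {n : ℕ} {A : Matrix (Fin n) (Fin n) ℝ}
    (hA : A.IsSymm) {μ ν : ℝ} (hne : μ ≠ ν) {v w : Fin n → ℝ} (hv : A.mulVec v = μ • v)
    (hw : A.mulVec w = ν • w) : v ⬝ᵥ w = 0 := by
  have h : (A *ᵥ v) ⬝ᵥ w = v ⬝ᵥ (A *ᵥ w) := by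
    rw [Matrix.dotProduct_mulVec, ← Matrix.mulVec_transpose, hA.eq]
  rw [hv, hw, smul_dotProduct, dotProduct_smul, smul_eq_mul, smul_eq_mul] at h
  have : (μ - ν) * (v ⬝ᵥ w) = 0 := by linarith
  exact (mul_eq_zero.mp this).resolve_left (sub_ne_zero.mpr hne)

theorem nodalCount_smul {n : ℕ} (A : Matrix (Fin n) (Fin n) ℝ) (v : Fin n → ℝ) {c : ℝ}
    (hc : c ≠ 0) : nodalCount A (c • v) = nodalCount A v := by
  refine Nat.card_congr (Equiv.subtypeEquivRight fun p => and_congr_right fun _ => ?_)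
  have h : A p.1 p.2 * (c • v) p.1 * (c • v) p.2 = c ^ 2 * (A p.1 p.2 * v p.1 * v p.2) := by
    simp only [Pi.smul_apply, smul_eq_mul]
    ring
  rw [h, mul_pos_iff_of_pos_left (by positivity)]

/-- for a connected graph `G` and a real symmetric matrix `A` satisfying the
Nodal Count Condition (strictly supported on `G`, simple eigenvalues `lam 0 < … < lam (n-1)`
with nowhere-vanishing eigenvectors `φ k`), the total nodal surplus is at least `β(G)`. -/
theorem total_nodal_surplus_lower_bound {n : ℕ} (G : SimpleGraph (Fin n)) (hG : G.Connected)
    (A : Matrix (Fin n) (Fin n) ℝ) (hA : A.IsSymm)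
    (hsupp : SupportedOn G A) (hstrict : ∀ i j, G.Adj i j → A i j ≠ 0)
    (lam : Fin n → ℝ) (φ : Fin n → Fin n → ℝ) (hlam : StrictMono lam)
    (heig : ∀ k, A.mulVec (φ k) = lam k • φ k) (hnv : ∀ k i, φ k i ≠ 0) :
    (betti G : ℤ) ≤ ∑ k : Fin n, ((nodalCount A (φ k) : ℤ) - ((k : ℕ) : ℤ)) := by
  have hpos : ∀ k, 0 < φ k ⬝ᵥ φ k := fun k =>
    lt_of_le_of_ne (Finset.sum_nonneg fun i _ => mul_self_nonneg _) fun h =>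
      hnv k k (congrFun (dotProduct_self_eq_zero.mp h.symm) k)
  set c : Fin n → ℝ := fun k => (√(φ k ⬝ᵥ φ k))⁻¹ with hc_def
  have hc : ∀ k, c k ≠ 0 := fun k => inv_ne_zero (Real.sqrt_pos.mpr (hpos k)).ne'
  have hψ : Matrix.of (fun k => c k • φ k) * (Matrix.of fun k => c k • φ k)ᵀ = 1 := by
    ext k m
    have hkm : (Matrix.of (fun k => c k • φ k) * (Matrix.of fun k => c k • φ k)ᵀ) k m
        = (c k • φ k) ⬝ᵥ (c m • φ m) := rfl
    rw [hkm, smul_dotProduct, dotProduct_smul, smul_eq_mul, smul_eq_mul]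
    rcases eq_or_ne k m with rfl | h
    · rw [Matrix.one_apply_eq, ← mul_assoc, hc_def, ← mul_inv,
        Real.mul_self_sqrt (hpos k).le, inv_mul_cancel₀ (hpos k).ne']
    · rw [Matrix.one_apply_ne h, dotProduct_eq_zero_of_eigenvalue_ne hA (hlam.injective.ne h)
        (heig k) (heig m), mul_zero, mul_zero]
  have h := total_nodal_surplus_lower_bound_of_orthonormal hG hA hsupp hstrict hlam
    (ψ := fun k => c k • φ k)
    (fun k => by rw [Matrix.mulVec_smul, heig, smul_comm])
    (fun k i => mul_ne_zero (hc k) (hnv k i)) hψ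
  simpa only [nodalCount_smul A _ (hc _)] using h
end

section
/- For every integer n > 2 and every integer β with 0 ≤ β ≤ C(n−1,2), there exists a simple connected graph G on n vertices with first Betti number β(G)=β, and a real symmetric n×n matrix A satisfying the Nodal Count Condition for G, whose total nodal count equals Σ_{k=1}^{n} ν(A,φ_k) = C(n,2) + β (so its average nodal surplus equals β/n, attaining the lower bound of the main theorem). -/
open Matrix

open Filter Topology

/-- The function `μ ↦ ((μ - A)⁻¹ b)ᵢ` for a matrix `A` with eigenvalues `lam` and orthonormal
eigenvectors `φ k`, where `β k` are the coefficients of `b` in the eigenbasis. -/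
noncomputable def resolventEntry {m : ℕ} (lam β : Fin m → ℝ) (φ : Matrix (Fin m) (Fin m) ℝ)
    (μ : ℝ) (i : Fin m) : ℝ :=
  ∑ j, β j / (μ - lam j) * φ j i

theorem eventually_sign_eq {f : ℝ → ℝ} {a : ℝ} (hf : ContinuousAt f a) (h : f a ≠ 0) :
    ∀ᶠ μ in 𝓝 a, SignType.sign (f μ) = SignType.sign (f a) := by
  rcases lt_or_gt_of_ne h with h | h
  · filter_upwards [hf.eventually_lt_const h] with μ hμ
    rw [sign_neg h, sign_neg hμ]
  · filter_upwards [hf.eventually_const_lt h] with μ hμ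
    rw [sign_pos h, sign_pos hμ]

theorem continuousAt_div_sub_mul {a l : ℝ} (c e : ℝ) (h : a ≠ l) :
    ContinuousAt (fun μ => c / (μ - l) * e) a := by
  have : a - l ≠ 0 := sub_ne_zero.2 h
  fun_prop (disch := assumption)

theorem eventually_sign_resolventEntry_pole {m : ℕ} {lam β : Fin m → ℝ}
    {φ : Matrix (Fin m) (Fin m) ℝ} (hlam : Function.Injective lam) (k i : Fin m)
    (h : β k * φ k i ≠ 0) :
    ∀ᶠ μ in 𝓝[≠] (lam k), SignType.sign ((μ - lam k) * resolventEntry lam β φ μ i) =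
      SignType.sign (β k * φ k i) := by
  set f : ℝ → ℝ := fun μ => β k * φ k i +
    (μ - lam k) * ∑ j ∈ Finset.univ.erase k, β j / (μ - lam j) * φ j i with hf
  have hc : ContinuousAt f (lam k) := by
    refine continuousAt_const.add ((by fun_prop : ContinuousAt (fun μ => μ - lam k) _).mul ?_)
    refine tendsto_finsetSum _ fun j hj => ?_
    exact continuousAt_div_sub_mul _ _ fun h' => (Finset.ne_of_mem_erase hj) (hlam h').symm
  have hfk : f (lam k) = β k * φ k i := by simp [hf]
  have := eventually_sign_eq hc (hfk ▸ h)
  filter_upwards [self_mem_nhdsWithin, this.filter_mono nhdsWithin_le_nhds] with μ hμ h1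
  rw [hfk] at h1
  rw [← h1]
  congr 1
  have hμ' : μ - lam k ≠ 0 := sub_ne_zero.2 hμ
  rw [resolventEntry, ← Finset.add_sum_erase _ _ (Finset.mem_univ k), hf]
  field_simp

theorem eventually_exists_root_near_pole {m : ℕ} {lam β : Fin m → ℝ}
    (hlam : Function.Injective lam) {d : ℝ} {k : Fin m} (hβ : β k ≠ 0) (hd : d ≠ lam k)
    {P : ℝ → Prop} (hP : ∀ᶠ μ in 𝓝[≠] (lam k), P μ) :
    ∀ᶠ ε : ℝ in 𝓝[>] 0, ∃ μ, P μ ∧ (∀ j, μ ≠ lam j) ∧ 0 < (μ - lam k) * (lam k - d) ∧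
      d - μ + ε ^ 2 * ∑ j, β j ^ 2 / (μ - lam j) = 0 := by
  have hD : lam k - d ≠ 0 := sub_ne_zero.2 hd.symm
  have hline : Tendsto (fun τ : ℝ => lam k + τ * (lam k - d)) (𝓝 0) (𝓝 (lam k)) := by
    have : Continuous fun τ : ℝ => lam k + τ * (lam k - d) := by fun_prop
    simpa using this.tendsto 0
  have h1 : ∀ᶠ μ in 𝓝 (lam k), ∀ j, j ≠ k → μ ≠ lam j := by
    refine eventually_all.2 fun j => ?_
    by_cases hj : j = k
    · simp [hj]
    · filter_upwards [eventually_ne_nhds (fun h' => hj (hlam h').symm :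
        lam k ≠ lam j)] with μ hμ _ using hμ
  obtain ⟨δ, hδ, hball⟩ := Metric.eventually_nhds_iff.1
    (hline.eventually ((eventually_nhdsWithin_iff.1 hP).and h1))
  simp only [Real.dist_eq, sub_zero] at hball
  set S : ℝ → ℝ := fun τ =>
    ∑ j ∈ Finset.univ.erase k, β j ^ 2 / (lam k + τ * (lam k - d) - lam j) with hS
  set F : ℝ → ℝ → ℝ := fun ε τ => -(τ * (1 + τ) * (lam k - d) ^ 2) +
    ε ^ 2 * (τ * (lam k - d) * S τ + β k ^ 2) with hF
  have hcont : ∀ ε, ContinuousOn (F ε) (Set.Icc 0 (δ / 2)) := by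
    intro ε
    have hSc : ContinuousOn S (Set.Icc 0 (δ / 2)) := by
      refine continuousOn_finsetSum _ fun j hj => ?_
      refine continuousOn_const.div (by fun_prop) fun τ hτ => ?_
      refine sub_ne_zero.2 ((hball ?_).2 j (Finset.ne_of_mem_erase hj))
      rw [abs_of_nonneg hτ.1]; linarith [hτ.2]
    fun_prop
  have hev : ∀ᶠ ε : ℝ in 𝓝[>] 0, F ε (δ / 2) < 0 := by
    have hc : ContinuousAt (fun ε => F ε (δ / 2)) 0 := by fun_prop
    refine (hc.eventually_lt_const ?_).filter_mono nhdsWithin_le_nhds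
    simp only [hF]
    have : 0 < δ / 2 * (1 + δ / 2) * (lam k - d) ^ 2 := by positivity
    simpa using this
  filter_upwards [hev, self_mem_nhdsWithin] with ε hε hε0
  have hε0 : 0 < ε := hε0
  have hF0 : 0 < F ε 0 := by
    simp only [hF]; simp only [zero_mul, zero_add, neg_zero]; positivity
  obtain ⟨τ, hτ, hroot⟩ := intermediate_value_Icc' (by linarith) (hcont ε)
    (⟨hε.le, hF0.le⟩ : (0 : ℝ) ∈ Set.Icc (F ε (δ / 2)) (F ε 0))
  have hτ0 : 0 < τ := lt_of_le_of_ne hτ.1 fun h => by rw [← h] at hroot; linarith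
  have hτb : |τ| < δ := by rw [abs_of_pos hτ0]; linarith [hτ.2]
  have hne : lam k + τ * (lam k - d) ≠ lam k := by
    simpa using ⟨hτ0.ne', hD⟩
  refine ⟨lam k + τ * (lam k - d), (hball hτb).1 hne, fun j => ?_, ?_, ?_⟩
  · by_cases hj : j = k
    · rw [hj]; exact hne
    · exact (hball hτb).2 j hj
  · have : 0 < τ * (lam k - d) ^ 2 := by positivity
    linarith
  · rw [← Finset.add_sum_erase _ _ (Finset.mem_univ k)]
    have hS' : ∑ j ∈ Finset.univ.erase k, β j ^ 2 / (lam k + τ * (lam k - d) - lam j) = S τ := rfl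
    rw [hS']
    have hp : τ * (lam k - d) ≠ 0 := mul_ne_zero hτ0.ne' hD
    rw [add_sub_cancel_left]
    apply mul_left_cancel₀ hp
    have : τ * (lam k - d) * (β k ^ 2 / (τ * (lam k - d))) = β k ^ 2 := by field_simp
    simp only [hF] at hroot
    linear_combination hroot + ε ^ 2 * this

theorem eventually_exists_root_near_corner {m : ℕ} {lam β : Fin m → ℝ} {d : ℝ}
    (hd : ∀ k, d ≠ lam k) {P : ℝ → Prop} (hP : ∀ᶠ μ in 𝓝 d, P μ) :
    ∀ᶠ ε : ℝ in 𝓝[>] 0, ∃ μ, P μ ∧ (∀ j, μ ≠ lam j) ∧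
      d - μ + ε ^ 2 * ∑ j, β j ^ 2 / (μ - lam j) = 0 := by
  have h1 : ∀ᶠ μ in 𝓝 d, ∀ j, μ ≠ lam j :=
    eventually_all.2 fun j => eventually_ne_nhds (hd j)
  obtain ⟨δ, hδ, hball⟩ := Metric.eventually_nhds_iff.1 (hP.and h1)
  simp only [Real.dist_eq] at hball
  have hmem : ∀ μ ∈ Set.Icc (d - δ / 2) (d + δ / 2), |μ - d| < δ := fun μ hμ => by
    rw [abs_lt]; constructor <;> linarith [hμ.1, hμ.2]
  set F : ℝ → ℝ → ℝ := fun ε μ => d - μ + ε ^ 2 * ∑ j, β j ^ 2 / (μ - lam j) with hF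
  have hcont : ∀ ε, ContinuousOn (F ε) (Set.Icc (d - δ / 2) (d + δ / 2)) := by
    intro ε
    have : ContinuousOn (fun μ => ∑ j, β j ^ 2 / (μ - lam j))
        (Set.Icc (d - δ / 2) (d + δ / 2)) := by
      refine continuousOn_finsetSum _ fun j _ => ?_
      exact continuousOn_const.div (by fun_prop) fun μ hμ =>
        sub_ne_zero.2 ((hball (hmem μ hμ)).2 j)
    fun_prop
  have hev : ∀ μ, ContinuousAt (fun ε => F ε μ) 0 := fun μ => by fun_prop
  have h2 : ∀ᶠ ε in 𝓝 (0 : ℝ), F ε (d + δ / 2) < 0 :=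
    (hev _).eventually_lt_const (by simp only [hF]; simp; linarith)
  have h3 : ∀ᶠ ε in 𝓝 (0 : ℝ), 0 < F ε (d - δ / 2) :=
    (hev _).eventually_const_lt (by simp only [hF]; simp; linarith)
  filter_upwards [h2.filter_mono nhdsWithin_le_nhds, h3.filter_mono nhdsWithin_le_nhds]
    with ε h2 h3
  obtain ⟨μ, hμ, hroot⟩ := intermediate_value_Icc' (by linarith) (hcont ε)
    (⟨h2.le, h3.le⟩ : (0 : ℝ) ∈ Set.Icc (F ε (d + δ / 2)) (F ε (d - δ / 2)))
  exact ⟨μ, (hball (hmem μ hμ)).1, (hball (hmem μ hμ)).2, hroot⟩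

/-- The symmetric matrix obtained from `A` by adding a zeroth row and column with
corner entry `d` and off-diagonal entries `b`. -/
def border {m : ℕ} (A : Matrix (Fin m) (Fin m) ℝ) (b : Fin m → ℝ) (d : ℝ) :
    Matrix (Fin (m + 1)) (Fin (m + 1)) ℝ :=
  Fin.cons (Fin.cons d b) fun i => Fin.cons (b i) (A i)

section border
variable {m : ℕ} (A : Matrix (Fin m) (Fin m) ℝ) (b : Fin m → ℝ) (d : ℝ)

@[simp] theorem border_zero_zero : border A b d 0 0 = d := rfl
@[simp] theorem border_zero_succ (j : Fin m) : border A b d 0 j.succ = b j := rfl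
@[simp] theorem border_succ_zero (i : Fin m) : border A b d i.succ 0 = b i := rfl
@[simp] theorem border_succ_succ (i j : Fin m) : border A b d i.succ j.succ = A i j := rfl

theorem border_isSymm {A} (hA : A.IsSymm) : (border A b d).IsSymm := by
  ext i j
  cases i using Fin.cases <;> cases j using Fin.cases <;> simp [hA.apply]
end border

theorem mul_transpose_eq_transpose_mul_diagonal {m : ℕ} {A φ : Matrix (Fin m) (Fin m) ℝ}
    {lam : Fin m → ℝ} (heig : ∀ k, A *ᵥ φ k = lam k • φ k) : A * φᵀ = φᵀ * diagonal lam := by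
  ext i k
  have := congrFun (heig k) i
  simp only [mulVec, dotProduct, Pi.smul_apply, smul_eq_mul] at this
  rw [mul_diagonal, transpose_apply, mul_comm, ← this]
  rfl

theorem border_mulVec_resolvent {m : ℕ} {A φ : Matrix (Fin m) (Fin m) ℝ} {lam β b : Fin m → ℝ}
    (hφ : φ * φᵀ = 1) (heig : ∀ k, A *ᵥ φ k = lam k • φ k) (hb : b = φᵀ *ᵥ β)
    {d ε μ : ℝ} (hμ : ∀ j, μ ≠ lam j)
    (hroot : d - μ + ε ^ 2 * ∑ j, β j ^ 2 / (μ - lam j) = 0) :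
    border A (ε • b) d *ᵥ (Fin.cons 1 (ε • resolventEntry lam β φ μ)) =
      μ • (Fin.cons 1 (ε • resolventEntry lam β φ μ) : Fin (m + 1) → ℝ) := by
  have hx : resolventEntry lam β φ μ = φᵀ *ᵥ (fun j => β j / (μ - lam j)) := by
    ext i
    simp [resolventEntry, mulVec, dotProduct, mul_comm]
  have hβ : φ *ᵥ b = β := by rw [hb, mulVec_mulVec, hφ, one_mulVec]
  have h1 : A *ᵥ resolventEntry lam β φ μ + b = μ • resolventEntry lam β φ μ := by
    rw [hx, mulVec_mulVec, mul_transpose_eq_transpose_mul_diagonal heig, ← mulVec_mulVec,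
      hb, ← mulVec_add, ← mulVec_smul]
    congr 1
    ext j
    have := sub_ne_zero.2 (hμ j)
    simp [mulVec_diagonal]
    field_simp
    ring
  have h2 : b ⬝ᵥ resolventEntry lam β φ μ = ∑ j, β j ^ 2 / (μ - lam j) := by
    rw [hx, dotProduct_mulVec, vecMul_transpose, hβ]
    simp only [dotProduct]
    exact Finset.sum_congr rfl fun j _ => by ring
  ext i
  cases i using Fin.cases with
  | zero =>
    simp only [mulVec, dotProduct, Fin.sum_univ_succ, border_zero_zero, Fin.cons_zero,
      border_zero_succ, Fin.cons_succ, Pi.smul_apply, smul_eq_mul] at h2 ⊢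
    rw [← h2] at hroot
    rw [Finset.mul_sum] at hroot
    have : ∀ x, ε * b x * (ε * resolventEntry lam β φ μ x) =
      ε ^ 2 * (b x * resolventEntry lam β φ μ x) := fun x => by ring
    simp only [this]
    linarith
  | succ i =>
    have := congrFun h1 i
    simp only [mulVec, dotProduct, Fin.sum_univ_succ, border_succ_zero, Fin.cons_zero,
      border_succ_succ, Fin.cons_succ, Pi.smul_apply, smul_eq_mul, Pi.add_apply] at this ⊢
    have h' : ∀ x, A i x * (ε * resolventEntry lam β φ μ x) =
      ε * (A i x * resolventEntry lam β φ μ x) := fun x => by ring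
    simp only [h', ← Finset.mul_sum]
    linear_combination ε * this

theorem exists_orthonormal_rescaling {n : ℕ} {A : Matrix (Fin n) (Fin n) ℝ} (hA : A.IsSymm)
    {lam : Fin n → ℝ} (hlam : Function.Injective lam) {ψ : Matrix (Fin n) (Fin n) ℝ}
    (heig : ∀ k, A *ᵥ ψ k = lam k • ψ k) (hψ : ∀ k i, ψ k i ≠ 0) :
    ∃ φ : Matrix (Fin n) (Fin n) ℝ, φ * φᵀ = 1 ∧ (∀ k, A *ᵥ φ k = lam k • φ k) ∧
      ∀ k i, SignType.sign (φ k i) = SignType.sign (ψ k i) := by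
  have hpos : ∀ k, 0 < ψ k ⬝ᵥ ψ k := fun k =>
    Finset.sum_pos (fun i _ => mul_self_pos.2 (hψ k i)) ⟨k, Finset.mem_univ k⟩
  have horth : ∀ k l, k ≠ l → ψ k ⬝ᵥ ψ l = 0 := by
    intro k l hkl
    have h1 : ψ k ⬝ᵥ (A *ᵥ ψ l) = (A *ᵥ ψ k) ⬝ᵥ ψ l := by
      rw [dotProduct_mulVec, ← mulVec_transpose, hA.eq]
    rw [heig, heig, dotProduct_smul, smul_dotProduct, smul_eq_mul, smul_eq_mul] at h1
    have h2 : (lam l - lam k) * (ψ k ⬝ᵥ ψ l) = 0 := by linarith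
    exact (mul_eq_zero.1 h2).resolve_left (sub_ne_zero.2 fun h => hkl (hlam h).symm)
  refine ⟨fun k => (√(ψ k ⬝ᵥ ψ k))⁻¹ • ψ k, ?_, fun k => ?_, fun k i => ?_⟩
  · ext k l
    change ((√(ψ k ⬝ᵥ ψ k))⁻¹ • ψ k) ⬝ᵥ ((√(ψ l ⬝ᵥ ψ l))⁻¹ • ψ l) = _
    rw [dotProduct_smul, smul_dotProduct, smul_eq_mul, smul_eq_mul]
    by_cases h : k = l
    · subst h
      have := Real.sq_sqrt (hpos k).le
      have h0 := Real.sqrt_pos.2 (hpos k)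
      rw [one_apply_eq]
      field_simp
      linarith
    · rw [horth k l h, one_apply_ne h]; simp
  · rw [mulVec_smul, heig, smul_comm]
  · have h0 := inv_pos.2 (Real.sqrt_pos.2 (hpos k))
    change SignType.sign ((√(ψ k ⬝ᵥ ψ k))⁻¹ * ψ k i) = _
    rw [sign_mul, sign_pos h0, one_mul]

theorem exists_gap {n : ℕ} (D : Fin n → ℝ) :
    ∃ η : ℝ, 0 < η ∧ ∀ i j, D i < D j → D i + η < D j - η := by
  have : ∀ᶠ η in 𝓝 (0 : ℝ), ∀ i j, D i < D j → D i + η < D j - η := by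
    refine eventually_all.2 fun i => eventually_all.2 fun j => ?_
    by_cases h : D i < D j
    · have hc : ContinuousAt (fun η : ℝ => (D j - η) - (D i + η)) 0 := by fun_prop
      filter_upwards [hc.eventually_const_lt (show 0 < (D j - 0) - (D i + 0) by linarith)]
        with η hη _ using by linarith
    · simp [h]
  obtain ⟨η, h1, h2⟩ := ((this.filter_mono (nhdsWithin_le_nhds (s := Set.Ioi 0))).and
    self_mem_nhdsWithin).exists
  exact ⟨η, h2, h1⟩

/-- Limiting sign pattern of the eigenvectors of `border A (ε • b) d` for small `ε > 0`: row `0`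
belongs to the eigenvalue near `d`, row `k.succ` to the eigenvalue near `lam k`. -/
noncomputable def borderVec {m : ℕ} (lam β : Fin m → ℝ) (φ : Matrix (Fin m) (Fin m) ℝ) (d : ℝ) :
    Matrix (Fin (m + 1)) (Fin (m + 1)) ℝ :=
  Fin.cons (Fin.cons 1 (resolventEntry lam β φ d)) fun k => Fin.cons (β k * (lam k - d)) (φ k)

section borderVec
variable {m : ℕ} (lam β : Fin m → ℝ) (φ : Matrix (Fin m) (Fin m) ℝ) (d : ℝ)

@[simp] theorem borderVec_zero_zero : borderVec lam β φ d 0 0 = 1 := rfl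
@[simp] theorem borderVec_zero_succ (i : Fin m) :
    borderVec lam β φ d 0 i.succ = resolventEntry lam β φ d i := rfl
@[simp] theorem borderVec_succ_zero (k : Fin m) :
    borderVec lam β φ d k.succ 0 = β k * (lam k - d) := rfl
@[simp] theorem borderVec_succ_succ (k i : Fin m) : borderVec lam β φ d k.succ i.succ = φ k i := rfl
end borderVec

/-- Weakly coupling a new vertex to a matrix with a nowhere-vanishing eigenbasis: signs of the
perturbed eigenvectors. -/
theorem exists_border_eigenbasis {m : ℕ} {A φ : Matrix (Fin m) (Fin m) ℝ} (hA : A.IsSymm)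
    {lam β b : Fin m → ℝ} (hlam : Function.Injective lam)
    (hφ : φ * φᵀ = 1) (heig : ∀ k, A *ᵥ φ k = lam k • φ k) (hφ0 : ∀ k i, φ k i ≠ 0)
    (hb : b = φᵀ *ᵥ β) (hβ : ∀ k, β k ≠ 0) {d : ℝ} (hd : ∀ k, d ≠ lam k)
    (hx : ∀ i, resolventEntry lam β φ d i ≠ 0) :
    ∃ ε : ℝ, 0 < ε ∧ ∃ (lam' : Fin (m + 1) → ℝ) (φ' : Matrix (Fin (m + 1)) (Fin (m + 1)) ℝ),
      Function.Injective lam' ∧ φ' * φ'ᵀ = 1 ∧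
      (∀ k, border A (ε • b) d *ᵥ φ' k = lam' k • φ' k) ∧
      (∀ i j, (Fin.cons d lam : Fin (m + 1) → ℝ) i < (Fin.cons d lam : Fin (m + 1) → ℝ) j →
        lam' i < lam' j) ∧
      (∀ k i, SignType.sign (φ' k i) = SignType.sign (borderVec lam β φ d k i)) := by
  obtain ⟨η, hη, hgap⟩ := exists_gap (Fin.cons d lam : Fin (m + 1) → ℝ)
  have hnear : ∀ a : ℝ, ∀ᶠ μ in 𝓝 a, |μ - a| < η := fun a => Metric.ball_mem_nhds a hη
  have hpole := fun k => eventually_exists_root_near_pole hlam (hβ k) (hd k)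
    (((hnear (lam k)).filter_mono nhdsWithin_le_nhds).and (eventually_all.2 fun i =>
      eventually_sign_resolventEntry_pole hlam k i (mul_ne_zero (hβ k) (hφ0 k i))))
  have hcorner := eventually_exists_root_near_corner (β := β) hd
    ((hnear d).and (eventually_all.2 fun i => eventually_sign_eq
      (f := fun μ => resolventEntry lam β φ μ i) (a := d) (by
        refine tendsto_finsetSum _ fun j _ => ?_
        exact continuousAt_div_sub_mul _ _ (hd j)) (hx i)))
  obtain ⟨ε, ⟨hk, h0⟩, hε⟩ := (((eventually_all.2 hpole).and hcorner).and
    self_mem_nhdsWithin).exists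
  have hε : 0 < ε := hε
  choose μ hμ hμne hμside hμroot using hk
  obtain ⟨μ₀, hμ₀, hμ₀ne, hμ₀root⟩ := h0
  set lam' : Fin (m + 1) → ℝ := Fin.cons μ₀ μ with hlam'
  have hclose : ∀ i, |lam' i - (Fin.cons d lam : Fin (m + 1) → ℝ) i| < η := by
    intro i
    cases i using Fin.cases with
    | zero => exact hμ₀.1
    | succ i => exact (hμ i).1
  have hmono : ∀ i j, (Fin.cons d lam : Fin (m + 1) → ℝ) i < (Fin.cons d lam : Fin (m + 1) → ℝ) j →
      lam' i < lam' j := fun i j hij => by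
    have := hgap i j hij
    have h1 := abs_lt.1 (hclose i)
    have h2 := abs_lt.1 (hclose j)
    linarith [h1.2, h2.1]
  have hDinj : Function.Injective (Fin.cons d lam : Fin (m + 1) → ℝ) :=
    Fin.cons_injective_iff.2 ⟨fun ⟨k, hk⟩ => hd k hk.symm, hlam⟩
  have hinj : Function.Injective lam' := fun i j hij => by
    by_contra hne
    rcases lt_or_gt_of_ne (hDinj.ne hne) with h | h
    · exact (hmono _ _ h).ne hij
    · exact (hmono _ _ h).ne hij.symm
  set ψ : Matrix (Fin (m + 1)) (Fin (m + 1)) ℝ :=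
    Fin.cons (Fin.cons 1 (ε • resolventEntry lam β φ μ₀)) fun k =>
      ((μ k - lam k) * β k) • (Fin.cons 1 (ε • resolventEntry lam β φ (μ k))) with hψ
  have e0 : ψ 0 0 = 1 := rfl
  have s0 : ∀ i : Fin m, SignType.sign (ψ 0 i.succ) =
      SignType.sign (resolventEntry lam β φ d i) := fun i => by
    have : ψ 0 i.succ = ε * resolventEntry lam β φ μ₀ i := rfl
    rw [this, sign_mul, sign_pos hε, one_mul, hμ₀.2]
  have s1 : ∀ k : Fin m, SignType.sign (ψ k.succ 0) =
      SignType.sign (β k * (lam k - d)) := fun k => by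
    have h1 : ψ k.succ 0 = (μ k - lam k) * β k * 1 := rfl
    have h2 : SignType.sign (μ k - lam k) = SignType.sign (lam k - d) := by
      rcases pos_and_pos_or_neg_and_neg_of_mul_pos (hμside k) with h | h
      · rw [sign_pos h.1, sign_pos h.2]
      · rw [sign_neg h.1, sign_neg h.2]
    rw [h1, mul_one, sign_mul, sign_mul, h2, mul_comm]
  have s2 : ∀ k i : Fin m, SignType.sign (ψ k.succ i.succ) = SignType.sign (φ k i) := fun k i => by
    have h1 : ψ k.succ i.succ = (μ k - lam k) * β k * (ε * resolventEntry lam β φ (μ k) i) := rfl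
    have h2 : ψ k.succ i.succ = ε * β k * ((μ k - lam k) * resolventEntry lam β φ (μ k) i) := by
      rw [h1]; ring
    rw [h2, sign_mul, (hμ k).2 i, ← sign_mul]
    have : ε * β k * (β k * φ k i) = (ε * β k ^ 2) * φ k i := by ring
    have hp : 0 < ε * β k ^ 2 := by have := hβ k; positivity
    rw [this, sign_mul, sign_pos hp, one_mul]
  have hψeig : ∀ k, border A (ε • b) d *ᵥ ψ k = lam' k • ψ k := by
    intro k
    cases k using Fin.cases with
    | zero => exact border_mulVec_resolvent hφ heig hb hμ₀ne hμ₀root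
    | succ k =>
      change border A (ε • b) d *ᵥ (((μ k - lam k) * β k) • _) = μ k • (((μ k - lam k) * β k) • _)
      rw [mulVec_smul, border_mulVec_resolvent hφ heig hb (hμne k) (hμroot k), smul_comm]
  have hsign : ∀ k i, SignType.sign (ψ k i) = SignType.sign (borderVec lam β φ d k i) := by
    intro k i
    cases k using Fin.cases with
    | zero =>
      cases i using Fin.cases with
      | zero => rw [e0]; simp
      | succ i => exact s0 i
    | succ k =>
      cases i using Fin.cases with
      | zero => exact s1 k
      | succ i => exact s2 k i
  have hψ0 : ∀ k i, ψ k i ≠ 0 := by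
    intro k i
    rw [← sign_ne_zero, hsign, sign_ne_zero]
    cases k using Fin.cases with
    | zero =>
      cases i using Fin.cases with
      | zero => simp
      | succ i => exact hx i
    | succ k =>
      cases i using Fin.cases with
      | zero => exact mul_ne_zero (hβ k) (sub_ne_zero.2 (hd k).symm)
      | succ i => exact hφ0 k i
  obtain ⟨φ', ho, he, hs⟩ :=
    exists_orthonormal_rescaling (border_isSymm (ε • b) d hA) hinj hψeig hψ0
  exact ⟨ε, hε, lam', φ', hinj, ho, he, hmono, fun k i => (hs k i).trans (hsign k i)⟩

/-- The number of ordered pairs `i ≠ j` with `0 < A i j * x i * x j`. -/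
noncomputable def pairCount {m : ℕ} (A : Matrix (Fin m) (Fin m) ℝ) (x : Fin m → ℝ) : ℕ :=
  ∑ i, ∑ j, if i ≠ j ∧ 0 < A i j * x i * x j then 1 else 0

/-- The number of ordered pairs `i ≠ j` with `A i j ≠ 0`. -/
noncomputable def offDiagCount {m : ℕ} (A : Matrix (Fin m) (Fin m) ℝ) : ℕ :=
  ∑ i, ∑ j, if i ≠ j ∧ A i j ≠ 0 then 1 else 0

/-- The graph of the nonzero off-diagonal entries of `A`. -/
def supportGraph {m : ℕ} (A : Matrix (Fin m) (Fin m) ℝ) : SimpleGraph (Fin m) :=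
  SimpleGraph.fromRel fun i j => A i j ≠ 0

theorem pairCount_congr {m : ℕ} {A A' : Matrix (Fin m) (Fin m) ℝ} {x x' : Fin m → ℝ}
    (hA : ∀ i j, i ≠ j → SignType.sign (A i j) = SignType.sign (A' i j))
    (hx : ∀ i, SignType.sign (x i) = SignType.sign (x' i)) :
    pairCount A x = pairCount A' x' := by
  refine Finset.sum_congr rfl fun i _ => Finset.sum_congr rfl fun j _ => if_congr ?_ rfl rfl
  refine and_congr_right fun hij => ?_
  rw [← sign_eq_one_iff, ← sign_eq_one_iff]
  simp only [sign_mul, hA i j hij, hx]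

theorem pairCount_border {m : ℕ} (A : Matrix (Fin m) (Fin m) ℝ) (b : Fin m → ℝ) (d : ℝ)
    (x : Fin (m + 1) → ℝ) :
    pairCount (border A b d) x = pairCount A (fun i => x i.succ) +
      2 * (Finset.univ.filter fun j => 0 < b j * x 0 * x j.succ).card := by
  have h : ∀ i, 0 < b i * x i.succ * x 0 ↔ 0 < b i * x 0 * x i.succ := fun i => by
    rw [mul_right_comm]
  simp only [pairCount, Finset.card_filter, Fin.sum_univ_succ, Finset.sum_add_distrib, ne_eq,
    not_true_eq_false, Fin.succ_ne_zero, (Fin.succ_ne_zero _).symm, not_false_eq_true, true_and,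
    false_and, if_false, border_zero_succ, border_succ_zero, border_succ_succ, h, Fin.succ_inj]
  ring

theorem offDiagCount_border {m : ℕ} (A : Matrix (Fin m) (Fin m) ℝ) (b : Fin m → ℝ) (d : ℝ) :
    offDiagCount (border A b d) = offDiagCount A + 2 * (Finset.univ.filter fun j => b j ≠ 0).card := by
  simp only [offDiagCount, Finset.card_filter, Fin.sum_univ_succ, Finset.sum_add_distrib, ne_eq,
    not_true_eq_false, Fin.succ_ne_zero, (Fin.succ_ne_zero _).symm, not_false_eq_true, true_and,
    false_and, if_false, border_zero_succ, border_succ_zero, border_succ_succ, Fin.succ_inj]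
  ring

theorem pairCount_eq_zero {m : ℕ} {A : Matrix (Fin m) (Fin m) ℝ} {x : Fin m → ℝ}
    (hA : ∀ i j, i ≠ j → A i j ≤ 0) (hx : ∀ i, 0 < x i) : pairCount A x = 0 := by
  refine Finset.sum_eq_zero fun i _ => Finset.sum_eq_zero fun j _ => if_neg ?_
  rintro ⟨hij, h⟩
  rw [mul_assoc] at h
  exact absurd h (not_lt.2 (mul_nonpos_of_nonpos_of_nonneg (hA i j hij)
    (mul_pos (hx i) (hx j)).le))

theorem supportGraph_border_connected {m : ℕ} {A : Matrix (Fin m) (Fin m) ℝ} {b : Fin m → ℝ}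
    {d : ℝ} (hA : (supportGraph A).Connected) {v : Fin m} (hv : b v ≠ 0) :
    (supportGraph (border A b d)).Connected := by
  let f : supportGraph A →g supportGraph (border A b d) :=
    { toFun := Fin.succ
      map_rel' := by
        intro i j h
        simpa [supportGraph] using h }
  have h0 : (supportGraph (border A b d)).Reachable 0 v.succ := by
    refine SimpleGraph.Adj.reachable ?_
    simp [supportGraph, hv, (Fin.succ_ne_zero _).symm]
  rw [SimpleGraph.connected_iff_exists_forall_reachable]
  refine ⟨0, fun i => ?_⟩
  cases i using Fin.cases with
  | zero => exact SimpleGraph.Reachable.refl _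
  | succ i => exact h0.trans ((hA v i).map f)

/-- `A` has simple spectrum `lam` with nowhere-vanishing orthonormal eigenvectors `φ k`,
nonpositive off-diagonal entries, connected support with `e` edges, a positive eigenvector `φ g`
for the smallest eigenvalue, and minimal total nodal count. -/
structure IsExtremal {m : ℕ} (A : Matrix (Fin m) (Fin m) ℝ) (lam : Fin m → ℝ)
    (φ : Matrix (Fin m) (Fin m) ℝ) (g : Fin m) (e : ℕ) : Prop where
  symm : A.IsSymm
  injective : Function.Injective lam
  orthonormal : φ * φᵀ = 1
  eigen : ∀ k, A *ᵥ φ k = lam k • φ k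
  ne_zero : ∀ k i, φ k i ≠ 0
  nonpos : ∀ i j, i ≠ j → A i j ≤ 0
  ground_pos : ∀ i, 0 < φ g i
  ground_lt : ∀ k, k ≠ g → lam g < lam k
  connected : (supportGraph A).Connected
  edges : offDiagCount A = 2 * e
  total : ∑ k, pairCount A (φ k) + 3 * m = m * m + 2 * e + 2

/-- Each `φ k` with `k ≠ g` has constant sign off `c k` and the opposite sign at `c k`. -/
def OneVersusRest {m : ℕ} (φ : Matrix (Fin m) (Fin m) ℝ) (g : Fin m) (c : Fin m → Fin m) : Prop :=
  ∀ k, k ≠ g → ∀ j, j ≠ c k → φ k j * φ k (c k) < 0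

theorem OneVersusRest.congr_sign {m : ℕ} {φ φ' : Matrix (Fin m) (Fin m) ℝ} {g : Fin m}
    {c : Fin m → Fin m} (h : OneVersusRest φ' g c)
    (hs : ∀ k i, SignType.sign (φ k i) = SignType.sign (φ' k i)) : OneVersusRest φ g c := by
  intro k hk j hj
  rw [← sign_eq_neg_one_iff, sign_mul, hs, hs, ← sign_mul, sign_eq_neg_one_iff]
  exact h k hk j hj

theorem IsExtremal.exists_border {m e : ℕ} {A φ : Matrix (Fin m) (Fin m) ℝ} {lam : Fin m → ℝ}
    {g : Fin m} (h : IsExtremal A lam φ g e) {β b : Fin m → ℝ} {d : ℝ} {g' : Fin (m + 1)} {s : ℕ}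
    (hb : b = φᵀ *ᵥ β) (hβ : ∀ k, β k ≠ 0) (hd : ∀ k, d ≠ lam k)
    (hx : ∀ i, resolventEntry lam β φ d i ≠ 0) (hb0 : ∀ j, b j ≤ 0)
    (hs0 : 0 < s) (hs : (Finset.univ.filter fun j => b j ≠ 0).card = s)
    (hg : ∀ i, 0 < borderVec lam β φ d g' i)
    (hglt : ∀ k, k ≠ g' → (Fin.cons d lam : Fin (m + 1) → ℝ) g' <
      (Fin.cons d lam : Fin (m + 1) → ℝ) k)
    (htot : pairCount A (resolventEntry lam β φ d) +
      2 * (Finset.univ.filter fun j => 0 < b j * resolventEntry lam β φ d j).card +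
      2 * ∑ k, (Finset.univ.filter fun j => 0 < b j * (β k * (lam k - d)) * φ k j).card + 2
        = 2 * m + 2 * s) :
    ∃ ε : ℝ, 0 < ε ∧ ∃ lam' φ', IsExtremal (border A (ε • b) d) lam' φ' g' (e + s) ∧
      ∀ k i, SignType.sign (φ' k i) = SignType.sign (borderVec lam β φ d k i) := by
  obtain ⟨ε, hε, lam', φ', hinj, ho, he, hmono, hsign⟩ := exists_border_eigenbasis h.symm
    h.injective h.orthonormal h.eigen h.ne_zero hb hβ hd hx
  have hbv : ∀ k i, borderVec lam β φ d k i ≠ 0 := by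
    intro k i
    cases k using Fin.cases with
    | zero =>
      cases i using Fin.cases with
      | zero => simp
      | succ i => exact hx i
    | succ k =>
      cases i using Fin.cases with
      | zero => exact mul_ne_zero (hβ k) (sub_ne_zero.2 (hd k).symm)
      | succ i => exact h.ne_zero k i
  have hsupp : ∀ j, (ε • b) j ≠ 0 ↔ b j ≠ 0 := fun j => by simp [hε.ne']
  refine ⟨ε, hε, lam', φ', ⟨border_isSymm _ _ h.symm, hinj, ho, he, fun k i => ?_, fun i j hij => ?_,
    fun i => ?_, fun k hk => hmono _ _ (hglt k hk), ?_, ?_, ?_⟩, hsign⟩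
  · rw [← sign_ne_zero, hsign, sign_ne_zero]; exact hbv k i
  · have : ∀ j, ε * b j ≤ 0 := fun j => mul_nonpos_of_nonneg_of_nonpos hε.le (hb0 j)
    cases i using Fin.cases with
    | zero =>
      cases j using Fin.cases with
      | zero => exact absurd rfl hij
      | succ j => exact this j
    | succ i =>
      cases j using Fin.cases with
      | zero => exact this i
      | succ j => exact h.nonpos i j fun h' => hij (by rw [h'])
  · rw [← sign_eq_one_iff, hsign, sign_eq_one_iff]; exact hg i
  · rw [← hs] at hs0
    obtain ⟨v, hv⟩ := Finset.card_pos.1 hs0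
    refine supportGraph_border_connected (v := v) h.connected ?_
    simpa [hε.ne'] using hv
  · rw [offDiagCount_border, h.edges]
    simp only [hsupp]
    rw [hs]; ring
  · have hcongr : ∀ k, pairCount (border A (ε • b) d) (φ' k) =
        pairCount (border A b d) (borderVec lam β φ d k) := by
      intro k
      refine pairCount_congr (fun i j hij => ?_) (hsign k)
      cases i using Fin.cases with
      | zero =>
        cases j using Fin.cases with
        | zero => exact absurd rfl hij
        | succ j => simp [sign_mul, sign_pos hε]
      | succ i =>
        cases j using Fin.cases with
        | zero => simp [sign_mul, sign_pos hε]
        | succ j => rfl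
    have h0 : pairCount (border A b d) (borderVec lam β φ d 0) =
        pairCount A (resolventEntry lam β φ d) +
          2 * (Finset.univ.filter fun j => 0 < b j * resolventEntry lam β φ d j).card := by
      rw [pairCount_border]
      congr! 4
      simp
    have h1 : ∀ k : Fin m, pairCount (border A b d) (borderVec lam β φ d k.succ) =
        pairCount A (φ k) +
          2 * (Finset.univ.filter fun j => 0 < b j * (β k * (lam k - d)) * φ k j).card :=
      fun k => pairCount_border _ _ _ _
    simp only [hcongr, Fin.sum_univ_succ, h0, h1, Finset.sum_add_distrib, ← Finset.mul_sum]
    have := h.total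
    linarith

theorem IsExtremal.le_ground {m e : ℕ} {A φ : Matrix (Fin m) (Fin m) ℝ} {lam : Fin m → ℝ}
    {g : Fin m} (h : IsExtremal A lam φ g e) (k : Fin m) : lam g ≤ lam k := by
  by_cases hk : k = g
  · rw [hk]
  · exact (h.ground_lt k hk).le

theorem IsExtremal.exists_border_below {m e : ℕ} {A φ : Matrix (Fin m) (Fin m) ℝ} {lam : Fin m → ℝ}
    {g : Fin m} (h : IsExtremal A lam φ g e) {β b : Fin m → ℝ} {s : ℕ}
    (hb : b = φᵀ *ᵥ β) (hβ : ∀ k, β k ≠ 0) (hβg : β g < 0) (hb0 : ∀ j, b j ≤ 0)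
    (hs0 : 0 < s) (hs : (Finset.univ.filter fun j => b j ≠ 0).card = s)
    (htot : ∑ k, (Finset.univ.filter fun j => 0 < b j * β k * φ k j).card + 1 = m + s) :
    ∃ ε : ℝ, 0 < ε ∧ ∃ d lam' φ', IsExtremal (border A (ε • b) d) lam' φ' 0 (e + s) ∧
      (∀ k, d < lam k) ∧
      ∀ k i, SignType.sign (φ' k i) = SignType.sign (borderVec lam β φ d k i) := by
  obtain ⟨d, hd, hx⟩ : ∃ d, d < lam g ∧ ∀ i, 0 < resolventEntry lam β φ d i := by
    have h1 := eventually_all.2 fun i => eventually_sign_resolventEntry_pole (β := β) h.injective g i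
      (mul_ne_zero (hβ g) (h.ne_zero g i))
    have h2 : ∀ᶠ d in 𝓝[<] (lam g), _ :=
      h1.filter_mono (nhdsWithin_mono _ fun x hx => ne_of_lt hx)
    obtain ⟨d, h3, h4⟩ := (h2.and self_mem_nhdsWithin).exists
    have h4 : d < lam g := h4
    refine ⟨d, h4, fun i => ?_⟩
    have h5 := h3 i
    rw [sign_neg (mul_neg_of_neg_of_pos hβg (h.ground_pos i)), sign_eq_neg_one_iff] at h5
    exact (mul_neg_iff.1 h5).elim (fun h6 => absurd h6.1 (by linarith)) fun h6 => h6.2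
  have hd' : ∀ k, d < lam k := fun k => hd.trans_le (h.le_ground k)
  suffices hsuff : _ ∧ _ ∧ _ by
    obtain ⟨ε, hε, lam', φ', h', hs'⟩ := h.exists_border (g' := 0) hb hβ (fun k => (hd' k).ne)
      (fun i => (hx i).ne') hb0 hs0 hs hsuff.1 hsuff.2.1 hsuff.2.2
    exact ⟨ε, hε, d, lam', φ', h', hd', hs'⟩
  refine ⟨?_, ?_, ?_⟩
  · intro i
    cases i using Fin.cases with
    | zero => simp
    | succ i => exact hx i
  · intro k hk
    cases k using Fin.cases with
    | zero => exact absurd rfl hk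
    | succ k => exact hd' k
  · have h1 : (Finset.univ.filter fun j => 0 < b j * resolventEntry lam β φ d j) = ∅ :=
      Finset.filter_eq_empty_iff.2 fun j _ =>
        not_lt.2 (mul_nonpos_of_nonpos_of_nonneg (hb0 j) (hx j).le)
    have h2 : ∀ k j, 0 < b j * (β k * (lam k - d)) * φ k j ↔ 0 < b j * β k * φ k j := fun k j => by
      have : b j * (β k * (lam k - d)) * φ k j = (lam k - d) * (b j * β k * φ k j) := by ring
      rw [this]
      exact mul_pos_iff_of_pos_left (sub_pos.2 (hd' k))
    simp only [h1, h2, pairCount_eq_zero h.nonpos hx, Finset.card_empty]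
    linarith

/-- There is an extremal matrix on `m` vertices with `e` edges. -/
def Extremal (m e : ℕ) : Prop :=
  ∃ (A : Matrix (Fin m) (Fin m) ℝ) (lam : Fin m → ℝ) (φ : Matrix (Fin m) (Fin m) ℝ) (g : Fin m),
    IsExtremal A lam φ g e

/-- There is an extremal matrix on `m` vertices with `e` edges whose excited eigenvectors all have
the sign pattern of `OneVersusRest`. -/
def SplitExtremal (m e : ℕ) : Prop :=
  ∃ (A : Matrix (Fin m) (Fin m) ℝ) (lam : Fin m → ℝ) (φ : Matrix (Fin m) (Fin m) ℝ) (g : Fin m)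
    (c : Fin m → Fin m), IsExtremal A lam φ g e ∧ OneVersusRest φ g c

/-- As `SplitExtremal`, on a complete graph and with a vertex that is never the exceptional one. -/
def CompleteSplitExtremal (m e : ℕ) : Prop :=
  ∃ (A : Matrix (Fin m) (Fin m) ℝ) (lam : Fin m → ℝ) (φ : Matrix (Fin m) (Fin m) ℝ) (g : Fin m)
    (c : Fin m → Fin m) (v : Fin m), IsExtremal A lam φ g e ∧ OneVersusRest φ g c ∧
      (∀ i j, i ≠ j → A i j < 0) ∧ ∀ k, k ≠ g → c k ≠ v

theorem SplitExtremal.extremal {m e : ℕ} : SplitExtremal m e → Extremal m e :=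
  fun ⟨A, lam, φ, g, _, h, _⟩ => ⟨A, lam, φ, g, h⟩

section pendant
variable {m : ℕ} {φ : Matrix (Fin m) (Fin m) ℝ} (v : Fin m)

theorem mulVec_neg_single_one (k : Fin m) : (φ *ᵥ (-Pi.single v 1)) k = -φ k v := by
  simp [mulVec_neg]

theorem neg_single_one_eq_transpose_mulVec (hφ : φ * φᵀ = 1) :
    (-Pi.single v 1 : Fin m → ℝ) = φᵀ *ᵥ (φ *ᵥ (-Pi.single v 1)) := by
  rw [mulVec_mulVec, mul_eq_one_comm.1 hφ, one_mulVec]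

theorem card_filter_neg_single_one_ne_zero :
    (Finset.univ.filter fun j => (-Pi.single v 1 : Fin m → ℝ) j ≠ 0).card = 1 := by
  rw [Finset.card_eq_one]
  exact ⟨v, by ext j; simp [Pi.single_apply]⟩

theorem neg_single_one_nonpos (j : Fin m) : (-Pi.single v 1 : Fin m → ℝ) j ≤ 0 := by
  by_cases h : j = v <;> simp [h]

end pendant

theorem Extremal.pendant {m e : ℕ} (h : Extremal m e) : Extremal (m + 1) (e + 1) := by
  obtain ⟨A, lam, φ, v, h⟩ := h
  obtain ⟨ε, -, d, lam', φ', h', -⟩ := h.exists_border_below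
    (neg_single_one_eq_transpose_mulVec v h.orthonormal)
    (fun k => by rw [mulVec_neg_single_one]; exact neg_ne_zero.2 (h.ne_zero k v))
    (by rw [mulVec_neg_single_one]; exact neg_neg_of_pos (h.ground_pos v))
    (neg_single_one_nonpos v) one_pos (card_filter_neg_single_one_ne_zero v) (by
      have : ∀ k, (Finset.univ.filter fun j => 0 < (-Pi.single v 1 : Fin m → ℝ) j *
          (φ *ᵥ (-Pi.single v 1)) k * φ k j).card = 1 := by
        intro k
        rw [Finset.card_eq_one]
        refine ⟨v, ?_⟩
        ext j
        rw [mulVec_neg_single_one]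
        by_cases hj : j = v
        · subst hj; simpa using h.ne_zero k j
        · simp [hj]
      rw [Finset.sum_congr rfl fun k _ => this k]
      simp)
  exact ⟨_, _, _, _, h'⟩

theorem exists_negative_combination {m : ℕ} {φ : Matrix (Fin m) (Fin m) ℝ} {g : Fin m}
    (hg : ∀ i, 0 < φ g i) (t : Fin m → ℝ) :
    ∃ δ : ℝ, 0 < δ ∧ ∀ i, (φᵀ *ᵥ fun k => if k = g then -1 else δ * t k) i < 0 := by
  have : ∀ᶠ δ in 𝓝 (0 : ℝ), ∀ i, (φᵀ *ᵥ fun k => if k = g then -1 else δ * t k) i < 0 := by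
    refine eventually_all.2 fun i => ?_
    have hc : ContinuousAt (fun δ : ℝ => ∑ k, φ k i * (if k = g then -1 else δ * t k)) 0 := by
      refine tendsto_finsetSum _ fun k _ => ?_
      by_cases hk : k = g
      · simp [hk]
      · simp only [hk, if_false]
        have : Continuous fun δ : ℝ => φ k i * (δ * t k) := by fun_prop
        exact this.tendsto 0
    refine hc.eventually_lt_const ?_
    simp [hg i]
  obtain ⟨δ, h1, h2⟩ := ((this.filter_mono (nhdsWithin_le_nhds (s := Set.Ioi 0))).and
    self_mem_nhdsWithin).exists
  exact ⟨δ, h2, h1⟩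

theorem IsExtremal.exists_dominating {m e : ℕ} {A φ : Matrix (Fin m) (Fin m) ℝ} {lam : Fin m → ℝ}
    {g : Fin m} (h : IsExtremal A lam φ g e) {c : Fin m → Fin m} (hc : OneVersusRest φ g c) :
    ∃ b d lam' φ', (∀ j, b j < 0) ∧ IsExtremal (border A b d) lam' φ' 0 (e + m) ∧
      OneVersusRest φ' 0 (Fin.cons 0 fun k => if k = g then 0 else (c k).succ) := by
  obtain ⟨δ, hδ, hneg⟩ := exists_negative_combination h.ground_pos fun k => -φ k (c k)
  set β : Fin m → ℝ := fun k => if k = g then -1 else δ * -φ k (c k) with hβ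
  have hβg : β g = -1 := by simp [hβ]
  have hβk : ∀ k, k ≠ g → β k = δ * -φ k (c k) := fun k hk => by simp [hβ, hk]
  set b := φᵀ *ᵥ β with hb
  have hm : 0 < m := g.pos
  have hcount : ∀ k, (Finset.univ.filter fun j => 0 < b j * β k * φ k j).card =
      if k = g then m else 1 := by
    intro k
    split_ifs with hk
    · subst hk
      rw [Finset.filter_true_of_mem, Finset.card_fin]
      intro j _
      rw [hβg]
      exact mul_pos (by linarith [hneg j]) (h.ground_pos j)
    · rw [Finset.card_eq_one]
      refine ⟨c k, ?_⟩
      ext j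
      simp only [Finset.mem_filter, Finset.mem_univ, true_and, Finset.mem_singleton]
      have h1 : b j * β k * φ k j = (δ * -b j) * (φ k j * φ k (c k)) := by rw [hβk k hk]; ring
      have h2 : 0 < δ * -b j := mul_pos hδ (neg_pos.2 (hneg j))
      rw [h1, mul_pos_iff_of_pos_left h2]
      refine ⟨fun h3 => ?_, fun h3 => ?_⟩
      · by_contra hj
        exact (hc k hk j hj).not_gt h3
      · rw [h3]; exact mul_self_pos.2 (h.ne_zero k _)
  obtain ⟨ε, hε, d, lam', φ', h', hd, hs⟩ := h.exists_border_below (β := β) (b := b) (s := m) rfl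
    (fun k => by
      by_cases hk : k = g
      · rw [hk, hβg]; norm_num
      · rw [hβk k hk]; exact mul_ne_zero hδ.ne' (neg_ne_zero.2 (h.ne_zero _ _)))
    (by rw [hβg]; norm_num) (fun j => (hneg j).le) hm
    (by rw [Finset.filter_true_of_mem fun j _ => (hneg j).ne, Finset.card_fin])
    (by
      simp only [hcount]
      rw [← Finset.add_sum_erase _ _ (Finset.mem_univ g), if_pos rfl,
        Finset.sum_congr rfl fun k hk => if_neg (Finset.ne_of_mem_erase hk)]
      simp
      omega)
  refine ⟨ε • b, d, lam', φ', fun j => mul_neg_of_pos_of_neg hε (hneg j), h',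
    OneVersusRest.congr_sign ?_ hs⟩
  intro k hk j hj
  cases k using Fin.cases with
  | zero => exact absurd rfl hk
  | succ k =>
    have hdk := sub_pos.2 (hd k)
    rw [Fin.cons_succ] at hj ⊢
    by_cases hkg : k = g
    · subst hkg
      rw [if_pos rfl] at hj ⊢
      obtain ⟨j, rfl⟩ := Fin.exists_succ_eq.2 hj
      rw [borderVec_succ_succ, borderVec_succ_zero, hβg]
      exact mul_neg_of_pos_of_neg (h.ground_pos j) (by linarith)
    · rw [if_neg hkg] at hj ⊢
      cases j using Fin.cases with
      | zero =>
        rw [borderVec_succ_succ, borderVec_succ_zero, hβk k hkg]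
        have h1 : 0 < δ * (lam k - d) * (φ k (c k) * φ k (c k)) :=
          mul_pos (mul_pos hδ hdk) (mul_self_pos.2 (h.ne_zero _ _))
        linarith
      | succ j => exact hc k hkg j fun h' => hj (by rw [h'])

theorem SplitExtremal.dominating {m e : ℕ} (h : SplitExtremal m e) :
    SplitExtremal (m + 1) (e + m) := by
  obtain ⟨A, lam, φ, g, c, h, hc⟩ := h
  obtain ⟨b, d, lam', φ', -, h', hc'⟩ := h.exists_dominating hc
  exact ⟨_, _, _, _, _, h', hc'⟩

theorem CompleteSplitExtremal.dominating {m e : ℕ} (h : CompleteSplitExtremal m e) :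
    CompleteSplitExtremal (m + 1) (e + m) := by
  obtain ⟨A, lam, φ, g, c, v, h, hc, hA, hv⟩ := h
  obtain ⟨b, d, lam', φ', hb, h', hc'⟩ := h.exists_dominating hc
  refine ⟨_, _, _, _, _, v.succ, h', hc', fun i j hij => ?_, fun k hk => ?_⟩
  · cases i using Fin.cases with
    | zero =>
      cases j using Fin.cases with
      | zero => exact absurd rfl hij
      | succ j => exact hb j
    | succ i =>
      cases j using Fin.cases with
      | zero => exact hb i
      | succ j => exact hA i j fun h' => hij (by rw [h'])
  · cases k using Fin.cases with
    | zero => exact absurd rfl hk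
    | succ k =>
      rw [Fin.cons_succ]
      split_ifs with hkg
      · exact (Fin.succ_ne_zero v).symm
      · simpa using hv k hkg

theorem CompleteSplitExtremal.one : CompleteSplitExtremal 1 0 := by
  refine ⟨0, 0, 1, 0, 0, 0, ⟨by simp, Function.injective_of_subsingleton _, by simp, ?_, ?_, ?_, ?_,
    ?_, ?_, ?_, ?_⟩, ?_, ?_, ?_⟩
  · intro k; simp
  · intro k i; rw [Subsingleton.elim k i, one_apply_eq]; norm_num
  · intro i j hij; simp
  · intro i; rw [Subsingleton.elim i 0, one_apply_eq]; norm_num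
  · intro k hk; exact absurd (Subsingleton.elim _ _) hk
  · exact { preconnected := fun u w => by rw [Subsingleton.elim u w] }
  · simp [offDiagCount]
  · simp [pairCount]
  · intro k hk; exact absurd (Subsingleton.elim _ _) hk
  · intro i j hij; exact absurd (Subsingleton.elim _ _) hij
  · intro k hk; exact absurd (Subsingleton.elim _ _) hk

theorem tendsto_mul_div_sub_atTop (c l : ℝ) : Tendsto (fun d => d * (c / (d - l))) atTop (𝓝 c) := by
  have h1 : Tendsto (fun d : ℝ => d - l) atTop atTop := tendsto_atTop_add_const_right _ _ tendsto_id
  have h2 : Tendsto (fun d : ℝ => c + c * l / (d - l)) atTop (𝓝 (c + 0)) :=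
    tendsto_const_nhds.add (h1.const_div_atTop _)
  rw [add_zero] at h2
  refine h2.congr' ?_
  filter_upwards [eventually_gt_atTop l] with d hd
  have : d - l ≠ 0 := (sub_pos.2 hd).ne'
  field_simp
  ring

theorem tendsto_mul_resolventEntry {m : ℕ} (lam β : Fin m → ℝ) (φ : Matrix (Fin m) (Fin m) ℝ)
    (i : Fin m) :
    Tendsto (fun d => d * resolventEntry lam β φ d i) atTop (𝓝 ((φᵀ *ᵥ β) i)) := by
  have h : Tendsto (fun d => ∑ j, d * (β j / (d - lam j)) * φ j i) atTop
      (𝓝 (∑ j, β j * φ j i)) :=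
    tendsto_finsetSum _ fun j _ => (tendsto_mul_div_sub_atTop _ _).mul_const _
  have e : (φᵀ *ᵥ β) i = ∑ j, β j * φ j i := by simp [mulVec, dotProduct, mul_comm]
  rw [e]
  simpa only [resolventEntry, Finset.mul_sum, mul_assoc] using h

theorem tendsto_sq_mul_resolventEntry {m : ℕ} {A φ : Matrix (Fin m) (Fin m) ℝ}
    {lam β b : Fin m → ℝ} (heig : ∀ k, A *ᵥ φ k = lam k • φ k) (hb : b = φᵀ *ᵥ β)
    {i : Fin m} (hi : b i = 0) :
    Tendsto (fun d => d * (d * resolventEntry lam β φ d i)) atTop (𝓝 ((A *ᵥ b) i)) := by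
  have e : (A *ᵥ b) i = (φᵀ *ᵥ fun j => lam j * β j) i := by
    rw [hb, mulVec_mulVec, mul_transpose_eq_transpose_mul_diagonal heig, ← mulVec_mulVec]
    congr 2
    ext j
    simp [mulVec_diagonal]
  rw [e]
  refine (tendsto_mul_resolventEntry lam (fun j => lam j * β j) φ i).congr' ?_
  have h1 : ∀ᶠ d in atTop, ∀ j, lam j < d := eventually_all.2 fun j => eventually_gt_atTop _
  filter_upwards [h1] with d hd
  have h2 : ∑ j, β j * φ j i = 0 := by
    rw [← hi, hb]; simp [mulVec, dotProduct, mul_comm]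
  congr 1
  rw [← sub_zero (d * _), ← h2, resolventEntry, resolventEntry, Finset.mul_sum,
    ← Finset.sum_sub_distrib]
  refine Finset.sum_congr rfl fun j _ => ?_
  have : d - lam j ≠ 0 := (sub_pos.2 (hd j)).ne'
  field_simp
  ring

theorem pairCount_complete {m : ℕ} {A : Matrix (Fin m) (Fin m) ℝ} (hA : ∀ i j, i ≠ j → A i j < 0)
    {x : Fin m → ℝ} {v : Fin m} (hv : x v < 0) (hx : ∀ i, i ≠ v → 0 < x i) :
    pairCount A x + 2 = 2 * m := by
  have hm : 0 < m := v.pos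
  have h1 : ∀ i j, i ≠ j → (0 < A i j * x i * x j ↔ i = v ∨ j = v) := by
    intro i j hij
    rw [mul_assoc, ← neg_mul_neg, mul_pos_iff_of_pos_left (neg_pos.2 (hA i j hij)), neg_pos]
    by_cases hi : i = v
    · subst hi
      simpa using mul_neg_of_neg_of_pos hv (hx j hij.symm)
    · by_cases hj : j = v
      · subst hj
        simpa using mul_neg_of_pos_of_neg (hx i hij) hv
      · simpa [hi, hj] using (mul_pos (hx i hi) (hx j hj)).le
  have h2 : ∀ i, (Finset.univ.filter fun j => i ≠ j ∧ 0 < A i j * x i * x j).card =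
      if i = v then m - 1 else 1 := by
    intro i
    have : (Finset.univ.filter fun j => i ≠ j ∧ 0 < A i j * x i * x j) =
        if i = v then Finset.univ.erase v else {v} := by
      ext j
      rw [Finset.mem_filter]
      have : (i ≠ j ∧ 0 < A i j * x i * x j) ↔ (i ≠ j ∧ (i = v ∨ j = v)) :=
        and_congr_right (h1 i j)
      rw [this]
      split_ifs with hi <;> simp <;> grind
    rw [this]
    split_ifs <;> simp
  simp only [pairCount, ← Finset.card_filter, h2]
  rw [← Finset.add_sum_erase _ _ (Finset.mem_univ v), if_pos rfl,
    Finset.sum_congr rfl fun k hk => if_neg (Finset.ne_of_mem_erase hk)]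
  simp
  omega

theorem CompleteSplitExtremal.pendant {m e : ℕ} (h : CompleteSplitExtremal m e) :
    SplitExtremal (m + 1) (e + 1) := by
  obtain ⟨A, lam, φ, g, c, v, h, hc, hA, hv⟩ := h
  set b : Fin m → ℝ := -Pi.single v 1 with hb
  set β := φ *ᵥ b with hβ
  have hbβ : b = φᵀ *ᵥ β := neg_single_one_eq_transpose_mulVec v h.orthonormal
  have hβk : ∀ k, β k = -φ k v := mulVec_neg_single_one v
  have hbv : b v = -1 := by simp [hb]
  have hbne : ∀ i, i ≠ v → b i = 0 := fun i hi => by simp [hb, hi]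
  obtain ⟨d, hd, hxv, hx⟩ : ∃ d, (∀ k, lam k < d) ∧ resolventEntry lam β φ d v < 0 ∧
      ∀ i, i ≠ v → 0 < resolventEntry lam β φ d i := by
    have h1 : ∀ᶠ d in atTop, ∀ j, lam j < d := eventually_all.2 fun j => eventually_gt_atTop _
    have h2 : ∀ᶠ d in atTop, resolventEntry lam β φ d v < 0 := by
      have := tendsto_mul_resolventEntry lam β φ v
      rw [← hbβ, hbv] at this
      filter_upwards [this.eventually_lt_const (show (-1 : ℝ) < 0 by norm_num),
        eventually_gt_atTop 0] with d h3 h4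
      exact (pos_iff_neg_of_mul_neg h3).1 h4
    have h3 : ∀ᶠ d in atTop, ∀ i, i ≠ v → 0 < resolventEntry lam β φ d i := by
      refine eventually_all.2 fun i => ?_
      by_cases hi : i = v
      · simp [hi]
      have := tendsto_sq_mul_resolventEntry h.eigen hbβ (hbne i hi)
      have hAb : 0 < (A *ᵥ b) i := by
        simpa [hb, mulVec_neg] using hA i v hi
      filter_upwards [this.eventually_const_lt hAb, eventually_gt_atTop 0] with d h3 h4 _
      exact pos_of_mul_pos_right (pos_of_mul_pos_right h3 h4.le) h4.le
    obtain ⟨d, h4, h5, h6⟩ := (h1.and (h2.and h3)).exists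
    exact ⟨d, h4, h5, h6⟩
  have hy : ∀ k, β k * (lam k - d) = (d - lam k) * φ k v := fun k => by rw [hβk]; ring
  suffices hsuff : _ ∧ _ ∧ _ by
    obtain ⟨ε, hε, lam', φ', h', hs'⟩ := h.exists_border (g' := g.succ) (d := d) hbβ
      (fun k => by rw [hβk]; exact neg_ne_zero.2 (h.ne_zero k v)) (fun k => (hd k).ne')
      (fun i => by
        by_cases hi : i = v
        · rw [hi]; exact hxv.ne
        · exact (hx i hi).ne')
      (neg_single_one_nonpos v) one_pos (card_filter_neg_single_one_ne_zero v)
      hsuff.1 hsuff.2.1 hsuff.2.2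
    refine ⟨_, _, _, _, Fin.cons v.succ fun k => (c k).succ, h', OneVersusRest.congr_sign ?_ hs'⟩
    intro k hk j hj
    cases k using Fin.cases with
    | zero =>
      rw [Fin.cons_zero] at hj ⊢
      cases j using Fin.cases with
      | zero => simpa using hxv
      | succ j => exact mul_neg_of_pos_of_neg (hx j fun h' => hj (by rw [h'])) hxv
    | succ k =>
      have hkg : k ≠ g := fun h' => hk (by rw [h'])
      rw [Fin.cons_succ] at hj ⊢
      cases j using Fin.cases with
      | zero =>
        rw [borderVec_succ_zero, borderVec_succ_succ, hy, mul_assoc]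
        exact mul_neg_of_pos_of_neg (sub_pos.2 (hd k)) (hc k hkg v (hv k hkg).symm)
      | succ j => exact hc k hkg j fun h' => hj (by rw [h'])
  refine ⟨fun i => ?_, fun k hk => ?_, ?_⟩
  · cases i using Fin.cases with
    | zero =>
      rw [borderVec_succ_zero, hy]
      exact mul_pos (sub_pos.2 (hd g)) (h.ground_pos v)
    | succ i => exact h.ground_pos i
  · cases k using Fin.cases with
    | zero => exact hd g
    | succ k => exact h.ground_lt k fun h' => hk (by rw [h'])
  · have h1 : (Finset.univ.filter fun j => 0 < b j * resolventEntry lam β φ d j).card = 1 := by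
      rw [Finset.card_eq_one]
      refine ⟨v, ?_⟩
      ext j
      by_cases hj : j = v
      · subst hj; simpa [hbv] using hxv
      · simp [hj, hbne j hj]
    have h2 : ∀ k, (Finset.univ.filter fun j =>
        0 < b j * (β k * (lam k - d)) * φ k j).card = 0 := by
      intro k
      rw [Finset.card_eq_zero, Finset.filter_eq_empty_iff]
      intro j _
      by_cases hj : j = v
      · subst hj
        rw [hbv, hy]
        have : 0 < (d - lam k) * (φ k j * φ k j) :=
          mul_pos (sub_pos.2 (hd k)) (mul_self_pos.2 (h.ne_zero k j))
        linarith
      · simp [hbne j hj]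
    rw [Finset.sum_congr rfl fun k _ => h2 k, h1]
    have := pairCount_complete hA hxv hx
    simp
    omega

theorem completeSplitExtremal_succ (t : ℕ) : CompleteSplitExtremal (t + 1) ((t + 1).choose 2) := by
  induction t with
  | zero => exact CompleteSplitExtremal.one
  | succ t ih =>
    have := ih.dominating
    rwa [show (t + 1).choose 2 + (t + 1) = (t + 1 + 1).choose 2 by
      rw [Nat.choose_succ_succ' (t + 1) 1, Nat.choose_one_right]; ring] at this

theorem SplitExtremal.add_dominating {t e : ℕ} (h : SplitExtremal (t + 1) e) (r : ℕ) :
    ∃ e', SplitExtremal (t + r + 1) e' ∧ e' + (t + 1).choose 2 = e + (t + r + 1).choose 2 := by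
  induction r with
  | zero => exact ⟨e, h, rfl⟩
  | succ r ih =>
    obtain ⟨e', h', he⟩ := ih
    refine ⟨_, h'.dominating, ?_⟩
    have : (t + (r + 1) + 1).choose 2 = (t + r + 1) + (t + r + 1).choose 2 := by
      rw [show t + (r + 1) + 1 = (t + r + 1) + 1 by ring, Nat.choose_succ_succ' (t + r + 1) 1,
        Nat.choose_one_right]
    omega

theorem Extremal.add_pendant {m e : ℕ} (h : Extremal m e) (r : ℕ) : Extremal (m + r) (e + r) := by
  induction r with
  | zero => exact h
  | succ r ih => exact ih.pendant

theorem exists_extremal {n β : ℕ} (hn : 2 ≤ n) (hβ : β ≤ (n - 1).choose 2) :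
    Extremal n (β + (n - 1)) := by
  have hex : ∃ M, β ≤ (M + 1).choose 2 := ⟨n - 2, by rwa [show n - 2 + 1 = n - 1 by omega]⟩
  set M := Nat.find hex with hM
  have hβM : β ≤ (M + 1).choose 2 := Nat.find_spec hex
  have hMn : M ≤ n - 2 := Nat.find_min' hex (by rwa [show n - 2 + 1 = n - 1 by omega])
  have hchoose : ∀ a : ℕ, (a + 1).choose 2 = a + a.choose 2 := fun a => by
    rw [Nat.choose_succ_succ' a 1, Nat.choose_one_right]
  obtain ⟨t, ht⟩ := Nat.exists_eq_add_of_le hβM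
  have htM : t ≤ M := by
    rcases Nat.eq_zero_or_pos M with h0 | hpos
    · rw [h0] at ht
      simp at ht
      omega
    · have := Nat.find_min hex (m := M - 1) (by omega)
      rw [Nat.sub_add_cancel hpos] at this
      have := hchoose M
      omega
  obtain ⟨e, h, he⟩ := (completeSplitExtremal_succ t).pendant.add_dominating (M - t)
  have h' := h.extremal.add_pendant (n - (M + 2))
  rw [show t + 1 + (M - t) + 1 = M + 1 + 1 by omega] at h' he
  rw [show M + 1 + 1 + (n - (M + 2)) = n by omega] at h'
  have h1 := hchoose (M + 1)
  have h2 := hchoose (t + 1)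
  convert h' using 1
  omega

theorem card_edgeSet_supportGraph {m : ℕ} {A : Matrix (Fin m) (Fin m) ℝ} (hA : A.IsSymm) :
    2 * Nat.card (supportGraph A).edgeSet = offDiagCount A := by
  classical
  rw [Nat.card_eq_fintype_card, ← SimpleGraph.edgeFinset_card,
    ← SimpleGraph.sum_degrees_eq_twice_card_edges]
  refine Finset.sum_congr rfl fun i _ => ?_
  rw [← SimpleGraph.card_neighborFinset_eq_degree, ← Finset.card_filter]
  congr 1
  ext j
  rw [SimpleGraph.mem_neighborFinset]
  simp [supportGraph, hA.apply]

theorem two_mul_nodalCount {m : ℕ} {A : Matrix (Fin m) (Fin m) ℝ} (hA : A.IsSymm)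
    (x : Fin m → ℝ) : 2 * nodalCount A x = pairCount A x := by
  have h1 : nodalCount A x = ∑ i, ∑ j, if i < j ∧ 0 < A i j * x i * x j then 1 else 0 := by
    rw [nodalCount, Nat.card_eq_fintype_card, Fintype.card_subtype, Finset.card_filter,
      Fintype.sum_prod_type]
  have h2 : nodalCount A x = ∑ i, ∑ j, if j < i ∧ 0 < A i j * x i * x j then 1 else 0 := by
    rw [h1, Finset.sum_comm]
    refine Finset.sum_congr rfl fun i _ => Finset.sum_congr rfl fun j _ => ?_
    rw [hA.apply, mul_right_comm]
  rw [two_mul]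
  nth_rewrite 1 [h1]
  rw [h2, ← Finset.sum_add_distrib]
  refine Finset.sum_congr rfl fun i _ => ?_
  rw [← Finset.sum_add_distrib]
  refine Finset.sum_congr rfl fun j _ => ?_
  rcases lt_trichotomy i j with h | h | h
  · simp [h, h.not_gt, h.ne]
  · simp [h]
  · simp [h, h.not_gt, h.ne']

/-- for every `n > 2` and `0 ≤ β ≤ C(n-1,2)` there is a connected graph `G`
on `n` vertices with `β(G) = β` and a matrix `A` satisfying the Nodal Count Condition for `G`
whose total nodal count is `C(n,2) + β`. -/
theorem exists_extremal_graph_and_matrix (n β : ℕ) (hn : 2 < n) (hβ : β ≤ (n - 1).choose 2) :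
    ∃ G : SimpleGraph (Fin n), G.Connected ∧ betti G = β ∧
      ∃ (A : Matrix (Fin n) (Fin n) ℝ) (lam : Fin n → ℝ) (φ : Fin n → Fin n → ℝ),
        A.IsSymm ∧ SupportedOn G A ∧ (∀ i j, G.Adj i j → A i j ≠ 0) ∧
        StrictMono lam ∧ (∀ k, A.mulVec (φ k) = lam k • φ k) ∧ (∀ k i, φ k i ≠ 0) ∧
        ∑ k : Fin n, nodalCount A (φ k) = n.choose 2 + β := by
  obtain ⟨A, lam, φ, g, h⟩ := exists_extremal hn.le hβ
  have hE := card_edgeSet_supportGraph h.symm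
  rw [h.edges] at hE
  refine ⟨supportGraph A, h.connected, by rw [betti]; omega, A, lam ∘ Tuple.sort lam,
    fun k => φ (Tuple.sort lam k), h.symm, fun i j hij hadj => ?_, fun i j hadj => ?_,
    (Tuple.monotone_sort lam).strictMono_of_injective (h.injective.comp (Equiv.injective _)),
    fun k => h.eigen _, fun k i => h.ne_zero _ _, ?_⟩
  · by_contra hne
    exact hadj (by simp [supportGraph, hij, hne])
  · simpa [supportGraph, h.symm.apply, hadj.ne] using hadj
  · rw [Equiv.sum_comp (Tuple.sort lam) fun k => nodalCount A (φ k)]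
    have h1 := h.total
    simp only [← two_mul_nodalCount h.symm, ← Finset.mul_sum] at h1
    have h2 : 2 * n.choose 2 + n = n * n := by
      rw [Nat.choose_two_right, Nat.mul_div_cancel' (Nat.even_mul_pred_self n).two_dvd]
      obtain ⟨m, rfl⟩ := Nat.exists_eq_succ_of_ne_zero (by omega : n ≠ 0)
      simp; ring
    omega
end

section
/- For every integer n > 2, there exists a real symmetric n×n matrix A with zero diagonal and all off-diagonal entries nonzero (i.e., A ∈ S_0(K_n) strictly supported on the complete graph K_n) that satisfies the Nodal Count Condition, and whose total nodal count equals Σ_{k=1}^{n} ν(A,φ_k) = (n−1)² = C(n,2) + C(n−1,2), attaining the lower bound of the main theorem for K_n since β(K_n)=C(n−1,2). -/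
open Matrix

/-- Isolating the `k`-th pole of a partial fraction sum. -/
theorem sum_div_sub_eq {ι : Type*} [Fintype ι] [DecidableEq ι] (lam a : ι → ℝ) (k : ι) (μ : ℝ)
    (h : μ ≠ lam k) :
    (μ - lam k) * ∑ j, a j / (μ - lam j) =
      a k + (μ - lam k) * ∑ j ∈ Finset.univ.erase k, a j / (μ - lam j) := by
  have h' : μ - lam k ≠ 0 := sub_ne_zero.2 h
  rw [← Finset.add_sum_erase Finset.univ _ (Finset.mem_univ k), mul_add, mul_div_cancel₀ _ h']

open Filter Topology in
/-- For small positive `s`, the secular equation `μ = s ∑ w j / (μ - lam j)` has a solution close to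
each pole `lam k`, lying on the side of `lam k` away from zero. -/
theorem eventually_exists_secular_root_near_pole {ι : Type*} [Fintype ι] [DecidableEq ι]
    (lam w : ι → ℝ) (hinj : Function.Injective lam) (hw : ∀ j, 0 < w j) (k : ι) (hk : lam k ≠ 0)
    {Q : ℝ → Prop} (hQ : ∀ᶠ μ in 𝓝[≠] lam k, Q μ) :
    ∀ᶠ s in 𝓝[>] (0 : ℝ), ∃ μ, (∀ j, μ ≠ lam j) ∧ μ = s * ∑ j, w j / (μ - lam j) ∧
      0 < (μ - lam k) * lam k ∧ Q μ := by
  have hne : ∀ᶠ μ in 𝓝 (lam k), ∀ j, j ≠ k → μ ≠ lam j := by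
    rw [eventually_all]
    intro j
    by_cases hj : j = k
    · simp [hj]
    · have : lam k ≠ lam j := fun h => hj (hinj h).symm
      filter_upwards [isOpen_ne.mem_nhds this] with μ hμ _ using hμ
  rw [eventually_nhdsWithin_iff] at hQ
  have hcont : Tendsto (fun t : ℝ => lam k * (1 + t)) (𝓝 0) (𝓝 (lam k)) := by
    have : Continuous (fun t : ℝ => lam k * (1 + t)) := by fun_prop
    simpa using this.tendsto 0
  obtain ⟨τ, hτ, hball⟩ := Metric.eventually_nhds_iff.1 (hcont.eventually (hQ.and hne))
  have hsmall : ∀ t ∈ Set.Icc (0 : ℝ) (τ / 2), dist t 0 < τ := by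
    intro t ht
    rw [Real.dist_eq, sub_zero, abs_of_nonneg ht.1]
    linarith [ht.2]
  set r : ℝ → ℝ := fun t => ∑ j ∈ Finset.univ.erase k, w j / (lam k * (1 + t) - lam j) with hr
  have hrc : ContinuousOn r (Set.Icc 0 (τ / 2)) := by
    refine continuousOn_finsetSum _ fun j hj => ContinuousOn.div (by fun_prop) (by fun_prop) ?_
    intro t ht
    exact sub_ne_zero.2 ((hball (hsmall t ht)).2 j (Finset.ne_of_mem_erase hj))
  have hpos : ∀ᶠ s in 𝓝 (0 : ℝ), 0 < lam k ^ 2 * (1 + τ / 2) * (τ / 2)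
      - s * (w k + lam k * (τ / 2) * r (τ / 2)) := by
    have hc : Continuous (fun s : ℝ => lam k ^ 2 * (1 + τ / 2) * (τ / 2)
      - s * (w k + lam k * (τ / 2) * r (τ / 2))) := by fun_prop
    refine hc.continuousAt.eventually_const_lt ?_
    have := pow_pos (abs_pos.2 hk) 2
    rw [sq_abs] at this
    simp only [zero_mul, sub_zero]
    positivity
  filter_upwards [nhdsWithin_le_nhds hpos, self_mem_nhdsWithin] with s hs hs0
  have hs0 : 0 < s := hs0
  have hgc : ContinuousOn (fun t => lam k ^ 2 * (1 + t) * t - s * (w k + lam k * t * r t))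
      (Set.Icc 0 (τ / 2)) := by fun_prop
  have hsw := mul_pos hs0 (hw k)
  obtain ⟨t, ht, hgt⟩ := intermediate_value_Icc (by positivity) hgc
    (show (0 : ℝ) ∈ Set.Icc _ _ from ⟨by simpa using hsw.le, hs.le⟩)
  have ht0 : 0 < t := by
    refine lt_of_le_of_ne ht.1 ?_
    rintro rfl
    simp at hgt
    rcases hgt with h | h
    · exact hs0.ne' h
    · exact (hw k).ne' h
  have hμk : lam k * (1 + t) ≠ lam k := by
    intro h
    have : lam k * t = 0 := by linarith
    simp [hk, ht0.ne'] at this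
  obtain ⟨h1, h2⟩ := hball (hsmall t ht)
  refine ⟨lam k * (1 + t), fun j => ?_, ?_, ?_, h1 hμk⟩
  · by_cases hj : j = k
    · rwa [hj]
    · exact h2 j hj
  · have hd : lam k * (1 + t) - lam k ≠ 0 := sub_ne_zero.2 hμk
    apply mul_left_cancel₀ hd
    rw [mul_left_comm _ s, sum_div_sub_eq lam w k _ hμk]
    simp only [hr] at hgt
    linear_combination hgt
  · have := mul_pos (pow_pos (abs_pos.2 hk) 2) ht0
    rw [sq_abs] at this
    linarith

open Filter Topology in
/-- For small `s`, the secular equation `μ = s ∑ w j / (μ - lam j)` has a solution close to zero. -/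
theorem eventually_exists_secular_root_near_zero {ι : Type*} [Fintype ι]
    (lam w : ι → ℝ) (hne : ∀ j, lam j ≠ 0)
    {Q : ℝ → Prop} (hQ : ∀ᶠ μ in 𝓝 (0 : ℝ), Q μ) :
    ∀ᶠ s in 𝓝[>] (0 : ℝ), ∃ μ, (∀ j, μ ≠ lam j) ∧ μ = s * ∑ j, w j / (μ - lam j) ∧ Q μ := by
  have hne' : ∀ᶠ μ in 𝓝 (0 : ℝ), ∀ j, μ ≠ lam j :=
    eventually_all.2 fun j => isOpen_ne.mem_nhds (hne j).symm
  obtain ⟨τ, hτ, hball⟩ := Metric.eventually_nhds_iff.1 (hQ.and hne')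
  have hsmall : ∀ t ∈ Set.Icc (-(τ / 2)) (τ / 2), dist t 0 < τ := by
    intro t ht
    rw [Real.dist_eq, sub_zero, abs_lt]
    constructor <;> linarith [ht.1, ht.2]
  set r : ℝ → ℝ := fun t => ∑ j, w j / (t - lam j) with hr
  have hrc : ContinuousOn r (Set.Icc (-(τ / 2)) (τ / 2)) := by
    refine continuousOn_finsetSum _ fun j _ => ContinuousOn.div (by fun_prop) (by fun_prop) ?_
    intro t ht
    exact sub_ne_zero.2 ((hball (hsmall t ht)).2 j)
  have hright : ∀ᶠ s in 𝓝 (0 : ℝ), 0 < τ / 2 - s * r (τ / 2) := by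
    have hc : Continuous (fun s : ℝ => τ / 2 - s * r (τ / 2)) := by fun_prop
    refine hc.continuousAt.eventually_const_lt ?_
    simpa using hτ
  have hleft : ∀ᶠ s in 𝓝 (0 : ℝ), -(τ / 2) - s * r (-(τ / 2)) < 0 := by
    have hc : Continuous (fun s : ℝ => -(τ / 2) - s * r (-(τ / 2))) := by fun_prop
    refine hc.continuousAt.eventually_lt_const ?_
    simpa using hτ
  filter_upwards [nhdsWithin_le_nhds hright, nhdsWithin_le_nhds hleft] with s hs1 hs2
  have hgc : ContinuousOn (fun t => t - s * r t) (Set.Icc (-(τ / 2)) (τ / 2)) := by fun_prop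
  obtain ⟨t, ht, hgt⟩ := intermediate_value_Icc (by linarith) hgc
    (show (0 : ℝ) ∈ Set.Icc _ _ from ⟨hs2.le, hs1.le⟩)
  obtain ⟨h1, h2⟩ := hball (hsmall t ht)
  exact ⟨t, h2, by simpa [hr, sub_eq_zero] using hgt, h1⟩

/-- `v` has exactly one positive entry, and all its other entries are negative. -/
def HasUniquePosEntry {n : ℕ} (v : Fin n → ℝ) : Prop :=
  ∃ i, 0 < v i ∧ ∀ j, j ≠ i → v j < 0

/-- `A` is symmetric with zero diagonal and negative off-diagonal entries, and `φ` is a system of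
eigenvectors for distinct nonzero eigenvalues `lam`, such that `φ m` is positive with a negative
eigenvalue while every other eigenvector has a unique positive entry and is negative elsewhere. -/
structure IsSinglePosSystem {n : ℕ} (A : Matrix (Fin n) (Fin n) ℝ) (lam : Fin n → ℝ)
    (φ : Fin n → Fin n → ℝ) (m : Fin n) : Prop where
  symm : A.IsSymm
  diag : ∀ i, A i i = 0
  neg : ∀ i j, i ≠ j → A i j < 0
  inj : Function.Injective lam
  ne_zero : ∀ k, lam k ≠ 0
  mulVec : ∀ k, A.mulVec (φ k) = lam k • φ k
  ground_neg : lam m < 0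
  ground_pos : ∀ i, 0 < φ m i
  unique_pos : ∀ k, k ≠ m → HasUniquePosEntry (φ k)

theorem HasUniquePosEntry.ne_zero {n : ℕ} {v : Fin n → ℝ} (h : HasUniquePosEntry v) (i : Fin n) :
    v i ≠ 0 := by
  obtain ⟨a, ha, hb⟩ := h
  by_cases hi : i = a
  · exact hi ▸ ha.ne'
  · exact (hb i hi).ne

theorem IsSinglePosSystem.apply_ne_zero {n : ℕ} {A : Matrix (Fin n) (Fin n) ℝ} {lam : Fin n → ℝ}
    {φ : Fin n → Fin n → ℝ} {m : Fin n} (h : IsSinglePosSystem A lam φ m) (k i : Fin n) :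
    φ k i ≠ 0 := by
  by_cases hk : k = m
  · exact hk ▸ (h.ground_pos i).ne'
  · exact (h.unique_pos k hk).ne_zero i

theorem IsSinglePosSystem.dotProduct_eq_zero {n : ℕ} {A : Matrix (Fin n) (Fin n) ℝ}
    {lam : Fin n → ℝ} {φ : Fin n → Fin n → ℝ} {m : Fin n} (h : IsSinglePosSystem A lam φ m)
    {j k : Fin n} (hjk : j ≠ k) : φ j ⬝ᵥ φ k = 0 := by
  have h1 : φ j ⬝ᵥ A.mulVec (φ k) = lam k * (φ j ⬝ᵥ φ k) := by
    rw [h.mulVec, dotProduct_smul, smul_eq_mul]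
  have h2 : φ j ⬝ᵥ A.mulVec (φ k) = lam j * (φ j ⬝ᵥ φ k) := by
    rw [Matrix.dotProduct_mulVec, ← Matrix.mulVec_transpose, h.symm.eq, h.mulVec, smul_dotProduct, smul_eq_mul]
  have h3 : (lam j - lam k) * (φ j ⬝ᵥ φ k) = 0 := by linarith
  exact (mul_eq_zero.1 h3).resolve_left (sub_ne_zero.2 fun e => hjk (h.inj e))

theorem IsSinglePosSystem.dotProduct_self_pos {n : ℕ} {A : Matrix (Fin n) (Fin n) ℝ}
    {lam : Fin n → ℝ} {φ : Fin n → Fin n → ℝ} {m : Fin n} (h : IsSinglePosSystem A lam φ m)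
    (k : Fin n) : 0 < φ k ⬝ᵥ φ k :=
  Finset.sum_pos (fun i _ => mul_self_pos.2 (h.apply_ne_zero k i)) ⟨k, Finset.mem_univ k⟩

/-- The bordered matrix with corner entry `0` and border `b`. -/
def zeroBordered {n : ℕ} (A : Matrix (Fin n) (Fin n) ℝ) (b : Fin n → ℝ) :
    Matrix (Fin (n + 1)) (Fin (n + 1)) ℝ :=
  Matrix.of (Fin.cons (Fin.cons 0 b) fun i => Fin.cons (b i) (A i))

theorem zeroBordered_mulVec_cons {n : ℕ} (A : Matrix (Fin n) (Fin n) ℝ) (b u : Fin n → ℝ) (x : ℝ) :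
    (zeroBordered A b).mulVec (Fin.cons x u) = Fin.cons (b ⬝ᵥ u) (x • b + A.mulVec u) := by
  ext i
  refine Fin.cases ?_ (fun i => ?_) i
  · simp [zeroBordered, Matrix.mulVec, dotProduct, Fin.sum_univ_succ]
  · simp [zeroBordered, Matrix.mulVec, dotProduct, Fin.sum_univ_succ, mul_comm]

/-- The resolvent at `μ` applied to `∑ c j • φ j`. -/
noncomputable def resolventVec {n : ℕ} (lam : Fin n → ℝ) (φ : Fin n → Fin n → ℝ) (c : Fin n → ℝ)
    (μ : ℝ) : Fin n → ℝ :=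
  fun i => ∑ j, c j * φ j i / (μ - lam j)

theorem resolventVec_eq_sum {n : ℕ} (lam : Fin n → ℝ) (φ : Fin n → Fin n → ℝ) (c : Fin n → ℝ)
    (μ : ℝ) : resolventVec lam φ c μ = ∑ j, (c j / (μ - lam j)) • φ j := by
  ext i
  simp only [resolventVec, Finset.sum_apply, Pi.smul_apply, smul_eq_mul]
  exact Finset.sum_congr rfl fun j _ => by ring

/-- A root of the secular equation gives an eigenvector of the bordered matrix. -/
theorem IsSinglePosSystem.zeroBordered_mulVec {n : ℕ} {A : Matrix (Fin n) (Fin n) ℝ}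
    {lam : Fin n → ℝ} {φ : Fin n → Fin n → ℝ} {m : Fin n} (h : IsSinglePosSystem A lam φ m)
    (c : Fin n → ℝ) (ε μ : ℝ) (hμ : ∀ j, μ ≠ lam j)
    (hroot : μ = ε ^ 2 * ∑ j, c j ^ 2 * (φ j ⬝ᵥ φ j) / (μ - lam j)) :
    (zeroBordered A (ε • ∑ j, c j • φ j)).mulVec
        (Fin.cons 1 (ε • resolventVec lam φ c μ) : Fin (n + 1) → ℝ) =
      μ • (Fin.cons 1 (ε • resolventVec lam φ c μ) : Fin (n + 1) → ℝ) := by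
  have hA : ∑ j, c j • φ j + A.mulVec (resolventVec lam φ c μ) =
      μ • resolventVec lam φ c μ := by
    rw [resolventVec_eq_sum, Matrix.mulVec_sum, Finset.smul_sum, ← Finset.sum_add_distrib]
    refine Finset.sum_congr rfl fun j _ => ?_
    have := sub_ne_zero.2 (hμ j)
    rw [Matrix.mulVec_smul, h.mulVec, smul_smul, smul_smul, ← add_smul]
    congr 1
    field_simp
    ring
  have hb : (∑ j, c j • φ j) ⬝ᵥ resolventVec lam φ c μ =
      ∑ j, c j ^ 2 * (φ j ⬝ᵥ φ j) / (μ - lam j) := by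
    rw [resolventVec_eq_sum, sum_dotProduct]
    refine Finset.sum_congr rfl fun j _ => ?_
    rw [dotProduct_sum, Finset.sum_eq_single j]
    · rw [smul_dotProduct, dotProduct_smul, smul_eq_mul, smul_eq_mul]
      ring
    · intro k _ hk
      rw [smul_dotProduct, dotProduct_smul, h.dotProduct_eq_zero hk.symm, smul_zero, smul_zero]
    · simp
  rw [zeroBordered_mulVec_cons]
  ext i
  refine Fin.cases ?_ (fun i => ?_) i
  · simp only [Fin.cons_zero, Pi.smul_apply, smul_eq_mul, mul_one]
    rw [smul_dotProduct, dotProduct_smul, hb, smul_eq_mul, smul_eq_mul]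
    linear_combination -hroot
  · have := congrFun hA i
    simp only [Fin.cons_succ, Pi.smul_apply, Pi.add_apply, smul_eq_mul, one_smul,
      Matrix.mulVec_smul] at this ⊢
    linear_combination ε * this

open Filter Topology in
/-- Near the pole `lam k`, the resolvent vector is dominated by `φ k`. -/
theorem IsSinglePosSystem.eventually_resolventVec_sign {n : ℕ} {A : Matrix (Fin n) (Fin n) ℝ}
    {lam : Fin n → ℝ} {φ : Fin n → Fin n → ℝ} {m : Fin n} (h : IsSinglePosSystem A lam φ m)
    (c : Fin n → ℝ) (k : Fin n) (hc : c k ≠ 0) :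
    ∀ᶠ μ in 𝓝[≠] lam k, ∀ i,
      0 < (μ - lam k) * resolventVec lam φ c μ i * (c k * φ k i) := by
  rw [eventually_all]
  intro i
  have hcont : ContinuousAt (fun μ => (c k * φ k i + (μ - lam k) *
      ∑ j ∈ Finset.univ.erase k, c j * φ j i / (μ - lam j)) * (c k * φ k i)) (lam k) := by
    refine ContinuousAt.mul (ContinuousAt.add (by fun_prop) (ContinuousAt.mul (by fun_prop) ?_))
      (by fun_prop)
    refine tendsto_finsetSum _ fun j hj => ContinuousAt.div (by fun_prop) (by fun_prop) ?_
    exact sub_ne_zero.2 fun e => Finset.ne_of_mem_erase hj (h.inj e).symm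
  have hpos := hcont.eventually_const_lt (u := 0) (by
    simpa using ⟨hc, h.apply_ne_zero k i⟩)
  filter_upwards [nhdsWithin_le_nhds hpos, self_mem_nhdsWithin] with μ h1 h2
  rw [resolventVec, sum_div_sub_eq lam (fun j => c j * φ j i) k μ h2]
  exact h1

open Filter Topology in
theorem IsSinglePosSystem.exists_coeff {n : ℕ} {A : Matrix (Fin n) (Fin n) ℝ}
    {lam : Fin n → ℝ} {φ : Fin n → Fin n → ℝ} {m : Fin n} (h : IsSinglePosSystem A lam φ m) :
    ∃ c : Fin n → ℝ, (∀ i, (∑ j, c j • φ j) i < 0) ∧ (∀ i, resolventVec lam φ c 0 i < 0) ∧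
      c m < 0 ∧ ∀ k, k ≠ m → c k * lam k < 0 := by
  let c : ℝ → Fin n → ℝ := fun η j => -η * lam j - if j = m then 1 else 0
  have hc : ∀ j, Continuous fun η => c η j := fun j => by
    simp only [c]
    fun_prop
  have h1 : ∀ᶠ η in 𝓝 (0 : ℝ), ∀ i, (∑ j, c η j • φ j) i < 0 := by
    rw [eventually_all]
    intro i
    have : Continuous fun η => (∑ j, c η j • φ j) i := by
      simp only [Finset.sum_apply, Pi.smul_apply, smul_eq_mul]
      fun_prop
    refine this.continuousAt.eventually_lt_const ?_
    simpa [c, ite_apply] using h.ground_pos i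
  have h2 : ∀ᶠ η in 𝓝 (0 : ℝ), ∀ i, resolventVec lam φ (c η) 0 i < 0 := by
    rw [eventually_all]
    intro i
    have : Continuous fun η => resolventVec lam φ (c η) 0 i := by
      simp only [resolventVec, div_eq_mul_inv]
      fun_prop
    refine this.continuousAt.eventually_lt_const ?_
    have := div_neg_of_pos_of_neg (h.ground_pos i) h.ground_neg
    simpa [resolventVec, c, neg_div, ite_div, div_neg] using this
  have h3 : ∀ᶠ η in 𝓝 (0 : ℝ), c η m < 0 :=
    (hc m).continuousAt.eventually_lt_const (by simp [c])
  obtain ⟨η, ⟨⟨h1, h2⟩, h3⟩, h0⟩ := ((((h1.and h2).and h3).filter_mono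
    nhdsWithin_le_nhds).and (self_mem_nhdsWithin : Set.Ioi (0 : ℝ) ∈ 𝓝[>] 0)).exists
  refine ⟨c η, h1, h2, h3, fun k hk => ?_⟩
  have := mul_pos (show 0 < η from h0) (pow_pos (abs_pos.2 (h.ne_zero k)) 2)
  rw [sq_abs] at this
  simp only [c, hk, if_false]
  linarith

open Filter Topology in
theorem IsSinglePosSystem.exists_succ {n : ℕ} {A : Matrix (Fin n) (Fin n) ℝ}
    {lam : Fin n → ℝ} {φ : Fin n → Fin n → ℝ} {m : Fin n} (h : IsSinglePosSystem A lam φ m) :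
    ∃ (A' : Matrix (Fin (n + 1)) (Fin (n + 1)) ℝ) (lam' : Fin (n + 1) → ℝ)
      (φ' : Fin (n + 1) → Fin (n + 1) → ℝ) (m' : Fin (n + 1)),
      IsSinglePosSystem A' lam' φ' m' := by
  obtain ⟨c, hb, hr, hcm, hck⟩ := h.exists_coeff
  have hc0 : ∀ k, c k ≠ 0 := by
    intro k
    by_cases hk : k = m
    · exact hk ▸ hcm.ne
    · exact fun e => by simpa [e] using hck k hk
  have hw : ∀ j, 0 < c j ^ 2 * (φ j ⬝ᵥ φ j) := fun j =>
    mul_pos (by have := hc0 j; positivity) (h.dotProduct_self_pos j)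
  have hinj : Function.Injective (Fin.cons 0 lam : Fin (n + 1) → ℝ) :=
    Fin.cons_injective_iff.2 ⟨fun ⟨k, hk⟩ => h.ne_zero k hk, h.inj⟩
  obtain ⟨U, hU, hdisj⟩ := (Set.finite_range (Fin.cons 0 lam : Fin (n + 1) → ℝ)).t2_separation
  have hpole : ∀ᶠ s in 𝓝[>] (0 : ℝ), ∀ k, ∃ μ, (∀ j, μ ≠ lam j) ∧
      μ = s * ∑ j, c j ^ 2 * (φ j ⬝ᵥ φ j) / (μ - lam j) ∧ 0 < (μ - lam k) * lam k ∧
      ((∀ i, 0 < (μ - lam k) * resolventVec lam φ c μ i * (c k * φ k i)) ∧ μ ∈ U (lam k)) :=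
    eventually_all.2 fun k => eventually_exists_secular_root_near_pole lam _ h.inj hw k
      (h.ne_zero k) ((h.eventually_resolventVec_sign c k (hc0 k)).and
        (nhdsWithin_le_nhds ((hU (lam k)).2.mem_nhds (hU (lam k)).1)))
  have hneg : ∀ᶠ μ in 𝓝 (0 : ℝ), ∀ i, resolventVec lam φ c μ i < 0 := by
    rw [eventually_all]
    intro i
    refine Tendsto.eventually_lt_const (hr i) ?_
    refine tendsto_finsetSum _ fun j _ => ContinuousAt.div (by fun_prop) (by fun_prop) ?_
    exact sub_ne_zero.2 (h.ne_zero j).symm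
  have hzero := eventually_exists_secular_root_near_zero lam (fun j => c j ^ 2 * (φ j ⬝ᵥ φ j))
    h.ne_zero (hneg.and ((hU 0).2.mem_nhds (hU 0).1))
  obtain ⟨s, ⟨hpole, hzero⟩, hs⟩ := ((hpole.and hzero).and
    (self_mem_nhdsWithin : Set.Ioi (0 : ℝ) ∈ 𝓝[>] 0)).exists
  obtain ⟨ε, hε, rfl⟩ : ∃ ε : ℝ, 0 < ε ∧ ε ^ 2 = s :=
    ⟨√s, Real.sqrt_pos.2 hs, Real.sq_sqrt (le_of_lt hs)⟩
  have key : ∀ K : Fin (n + 1), ∃ (μ : ℝ) (ψ : Fin (n + 1) → ℝ),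
      μ ∈ U ((Fin.cons 0 lam : Fin (n + 1) → ℝ) K) ∧ μ ≠ 0 ∧
      (zeroBordered A (ε • ∑ j, c j • φ j)).mulVec ψ = μ • ψ ∧
      (K = m.succ → μ < 0 ∧ ∀ i, 0 < ψ i) ∧ (K ≠ m.succ → HasUniquePosEntry ψ) := by
    refine Fin.cases ?_ fun k => ?_
    · obtain ⟨μ, hμ, hroot, hu, hμU⟩ := hzero
      have hψ := h.zeroBordered_mulVec c ε μ hμ hroot
      refine ⟨μ, _, hμU, ?_, hψ, fun e => absurd e (Fin.succ_ne_zero m).symm,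
        fun _ => ⟨0, by simp, ?_⟩⟩
      · rintro rfl
        have h0 := congrFun hψ 0
        rw [zeroBordered_mulVec_cons] at h0
        simp only [Fin.cons_zero, zero_smul, Pi.zero_apply] at h0
        have : 0 < (ε • ∑ j, c j • φ j) ⬝ᵥ (ε • resolventVec lam φ c 0) := by
          refine Finset.sum_pos (fun i _ => ?_) ⟨m, Finset.mem_univ m⟩
          exact mul_pos_of_neg_of_neg (mul_neg_of_pos_of_neg hε (hb i))
            (mul_neg_of_pos_of_neg hε (hu i))
        exact this.ne' h0
      · refine Fin.cases (fun e => absurd rfl e) fun i _ => ?_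
        simpa using mul_neg_of_pos_of_neg hε (hu i)
    · obtain ⟨μ, hμ, hroot, hside, hu, hμU⟩ := hpole k
      have hψ := h.zeroBordered_mulVec c ε μ hμ hroot
      have hμ0 : μ ≠ 0 := by
        rintro rfl
        nlinarith [sq_nonneg (lam k)]
      by_cases hk : k = m
      · subst hk
        have hlt : μ - lam k < 0 := by nlinarith [h.ground_neg]
        refine ⟨μ, _, by simpa using hμU, hμ0, hψ,
          fun _ => ⟨by linarith [h.ground_neg], ?_⟩, fun e => absurd rfl e⟩
        refine Fin.cases (by simp) fun i => ?_
        have h1 : 0 < ((μ - lam k) * c k * φ k i) * resolventVec lam φ c μ i := by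
          linarith [hu i]
        have h2 : 0 < (μ - lam k) * c k * φ k i :=
          mul_pos (mul_pos_of_neg_of_neg hlt hcm) (h.ground_pos i)
        simpa using mul_pos hε ((pos_iff_pos_of_mul_pos h1).1 h2)
      · have hlt : (μ - lam k) * c k < 0 := by
          have h1 := mul_neg_of_pos_of_neg hside (hck k hk)
          have h2 : 0 < lam k ^ 2 := by have := h.ne_zero k; positivity
          nlinarith
        have hsign : ∀ i, 0 < φ k i * -resolventVec lam φ c μ i := by
          intro i
          have h1 : 0 < ((μ - lam k) * c k) * (φ k i * resolventVec lam φ c μ i) := by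
            linarith [hu i]
          have := neg_of_mul_pos_right h1 hlt.le
          linarith
        refine ⟨μ, -(Fin.cons 1 (ε • resolventVec lam φ c μ) : Fin (n + 1) → ℝ),
          by simpa using hμU, hμ0, by rw [Matrix.mulVec_neg, hψ, smul_neg],
          fun e => absurd (Fin.succ_injective _ e) hk, fun _ => ?_⟩
        obtain ⟨i, hi, hj⟩ := h.unique_pos k hk
        refine ⟨i.succ, ?_, Fin.cases (by simp) fun j hji => ?_⟩
        · have := mul_pos hε ((pos_iff_pos_of_mul_pos (hsign i)).1 hi)
          simpa using this
        · have := mul_neg_of_pos_of_neg hε ((neg_iff_neg_of_mul_pos (hsign j)).1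
            (hj j fun e => hji (congrArg _ e)))
          simpa using this
  choose lam' φ' hlU hl0 heig hground huniq using key
  refine ⟨zeroBordered A (ε • ∑ j, c j • φ j), lam', φ', m.succ, ?_, ?_, ?_, ?_, hl0, heig,
    (hground _ rfl).1, (hground _ rfl).2, huniq⟩
  · ext i j
    refine Fin.cases ?_ (fun i => ?_) i <;> refine Fin.cases ?_ (fun j => ?_) j <;>
      simp [zeroBordered, h.symm.apply]
  · refine Fin.cases ?_ fun i => ?_ <;> simp [zeroBordered, h.diag]
  · have hεb : ∀ i, (ε • ∑ j, c j • φ j) i < 0 := fun i => mul_neg_of_pos_of_neg hε (hb i)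
    refine Fin.cases (Fin.cases (fun e => absurd rfl e) fun j _ => hεb j) fun i =>
      Fin.cases (fun _ => hεb i) fun j hij => h.neg i j fun e => hij (congrArg _ e)
  · intro j k hjk
    by_contra hne
    have := hdisj (Set.mem_range_self j) (Set.mem_range_self k) (fun e => hne (hinj e))
    exact Set.disjoint_left.1 this (hlU j) (hjk ▸ hlU k)

theorem exists_isSinglePosSystem (n : ℕ) (hn : 2 ≤ n) :
    ∃ (A : Matrix (Fin n) (Fin n) ℝ) (lam : Fin n → ℝ) (φ : Fin n → Fin n → ℝ) (m : Fin n),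
      IsSinglePosSystem A lam φ m := by
  induction n, hn using Nat.le_induction with
  | base =>
    refine ⟨!![0, -1; -1, 0], ![-1, 1], ![![1, 1], ![1, -1]], 0, ?_, ?_, ?_, ?_, ?_, ?_, ?_, ?_, ?_⟩
    · ext i j
      fin_cases i <;> fin_cases j <;> simp
    · intro i
      fin_cases i <;> simp
    · intro i j
      fin_cases i <;> fin_cases j <;> simp
    · intro i j
      fin_cases i <;> fin_cases j <;> norm_num
    · intro i
      fin_cases i <;> simp
    · intro k
      ext i
      fin_cases k <;> fin_cases i <;> simp
    · simp
    · intro i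
      fin_cases i <;> simp
    · intro k hk
      refine ⟨0, ?_, fun j hj => ?_⟩
      · fin_cases k <;> simp
      · fin_cases k <;> fin_cases j <;> simp_all
  | succ n _ ih =>
    obtain ⟨A, lam, φ, m, h⟩ := ih
    exact h.exists_succ

theorem nodalCount_eq_zero {n : ℕ} {A : Matrix (Fin n) (Fin n) ℝ} {v : Fin n → ℝ}
    (hA : ∀ i j, i ≠ j → A i j < 0) (hv : ∀ i, 0 < v i) : nodalCount A v = 0 := by
  have : IsEmpty {p : Fin n × Fin n // p.1 < p.2 ∧ 0 < A p.1 p.2 * v p.1 * v p.2} := by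
    refine ⟨fun ⟨p, hlt, hp⟩ => hp.not_gt ?_⟩
    exact mul_neg_of_neg_of_pos (mul_neg_of_neg_of_pos (hA _ _ hlt.ne) (hv _)) (hv _)
  exact Nat.card_of_isEmpty

theorem nodalCount_eq_sub_one {n : ℕ} {A : Matrix (Fin n) (Fin n) ℝ} {v : Fin n → ℝ}
    (hA : ∀ i j, i ≠ j → A i j < 0) (hv : HasUniquePosEntry v) : nodalCount A v = n - 1 := by
  obtain ⟨i, hi, hj⟩ := hv
  have hsub : ∀ p : Fin n × Fin n, (p.1 < p.2 ∧ 0 < A p.1 p.2 * v p.1 * v p.2) ↔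
      p.1 < p.2 ∧ (p.1 = i ∨ p.2 = i) := by
    rintro ⟨a, b⟩
    refine and_congr_right fun hab => ?_
    have hab : a < b := hab
    have hA' := hA a b hab.ne
    simp only
    by_cases ha : a = i
    · subst ha
      have := hj b hab.ne'
      simpa using mul_pos_of_neg_of_neg (mul_neg_of_neg_of_pos hA' hi) this
    · by_cases hb : b = i
      · subst hb
        have := hj a ha
        simpa [ha] using mul_pos (mul_pos_of_neg_of_neg hA' this) hi
      · simpa [ha, hb] using
          (mul_neg_of_pos_of_neg (mul_pos_of_neg_of_neg hA' (hj a ha)) (hj b hb)).le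
  have e : {j : Fin n // j ≠ i} ≃ {p : Fin n × Fin n // p.1 < p.2 ∧ (p.1 = i ∨ p.2 = i)} :=
    Equiv.ofBijective (fun j => ⟨(min i j, max i j), by
      obtain ⟨j, hj⟩ := j
      rcases lt_or_gt_of_ne hj with h | h
      · simp [h.le, h]
      · simp [h.le, h]⟩) (by
      constructor
      · rintro ⟨a, ha⟩ ⟨b, hb⟩ hab
        simp only [Subtype.mk.injEq, Prod.mk.injEq] at hab
        grind
      · rintro ⟨⟨a, b⟩, hab, rfl | rfl⟩
        · exact ⟨⟨b, hab.ne'⟩, by simp [hab.le]⟩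
        · exact ⟨⟨a, hab.ne⟩, by simp [hab.le]⟩)
  rw [nodalCount, Nat.card_congr (Equiv.subtypeEquivRight hsub), ← Nat.card_congr e]
  simp [Fintype.card_subtype_compl]

theorem sq_sub_one_eq_choose_add_choose (n : ℕ) :
    (n - 1) ^ 2 = n.choose 2 + (n - 1).choose 2 := by
  rcases n with _ | n
  · rfl
  · rw [Nat.add_sub_cancel, Nat.choose_succ_succ' n 1, Nat.choose_one_right, add_assoc,
      ← two_mul, Nat.choose_two_right, Nat.mul_div_cancel' (Nat.even_mul_pred_self n).two_dvd]
    rcases n with _ | n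
    · rfl
    · rw [Nat.add_sub_cancel]
      ring

/-- for every `n > 2` there is a real symmetric `n × n` matrix with zero diagonal
and all off-diagonal entries nonzero (i.e. in `S₀(Kₙ)`, strictly supported on the complete
graph), satisfying the Nodal Count Condition, whose total nodal count equals
`(n-1)² = C(n,2) + C(n-1,2)`. -/
theorem exists_zero_diagonal_extremal_on_clique (n : ℕ) (hn : 2 < n) :
    ∃ (A : Matrix (Fin n) (Fin n) ℝ) (lam : Fin n → ℝ) (φ : Fin n → Fin n → ℝ),
      A.IsSymm ∧ (∀ i, A i i = 0) ∧ (∀ i j, i ≠ j → A i j ≠ 0) ∧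
      StrictMono lam ∧ (∀ k, A.mulVec (φ k) = lam k • φ k) ∧ (∀ k i, φ k i ≠ 0) ∧
      ∑ k : Fin n, nodalCount A (φ k) = (n - 1) ^ 2 ∧
      (n - 1) ^ 2 = n.choose 2 + (n - 1).choose 2 := by
  obtain ⟨A, lam, φ, m, h⟩ := exists_isSinglePosSystem n hn.le
  have hmono : StrictMono (lam ∘ Tuple.sort lam) :=
    (Tuple.monotone_sort lam).strictMono_of_injective (h.inj.comp (Tuple.sort lam).injective)
  refine ⟨A, lam ∘ Tuple.sort lam, φ ∘ Tuple.sort lam, h.symm, h.diag,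
    fun i j hij => (h.neg i j hij).ne, hmono, fun k => h.mulVec _,
    fun k i => h.apply_ne_zero _ i, ?_, sq_sub_one_eq_choose_add_choose n⟩
  simp only [Function.comp_apply]
  rw [Equiv.sum_comp (Tuple.sort lam) fun k => nodalCount A (φ k),
    ← Finset.add_sum_erase Finset.univ _ (Finset.mem_univ m),
    nodalCount_eq_zero h.neg h.ground_pos,
    Finset.sum_congr rfl fun k hk =>
      nodalCount_eq_sub_one h.neg (h.unique_pos k (Finset.ne_of_mem_erase hk))]
  simp [Finset.card_erase_of_mem, sq]
end
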